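/- arXiv:2505.00799 — 2 statements merged into one kernel-verified Lean document; each statement's English description precedes it below -/
import Mathlib

section
/- Let ℓ ∈ ℕ with ℓ ≥ 1 and set k = ℓ + 1/2. Let N ∈ ℕ with 4 ∣ N, and let f : ℍ → ℂ be holomorphic with Fourier expansion f(z) = ∑_{n≥1} a_n e^{2πinz} where |a_n| ≤ C n^σ for some C, σ > 0, satisfying: (i) for every γ = (a b; c d) ∈ Γ₀(N), f((az+b)/(cz+d)) = ε_d^{−2k} (c/d) (cz+d)^k f(z) for all z ∈ ℍ (principal branch of (cz+d)^k); (ii) for every rational r there exist δ, M > 0 with |f(r + iy)| ≤ M e^{−δ/y} for all 0 < y ≤ 1. Define the Eichler integral f̃(z) = ∑_{n≥1} a_n n^{1−k} e^{2πinz} for z ∈ ℍ. Then for every γ = (a b; c d) ∈ Γ₀(N) with c > 0, there exists a function H, analytic on the cut plane ℂ_γ := {z ∈ ℂ : cz + d ∉ (−∞, 0]}, such that H(z) = f̃(z) − χ_{−4}(d) · ε_d^{4−2k} · (c/d) · (cz+d)^{k−2} · f̃((az+b)/(cz+d)) for all z ∈ ℍ, where (cz+d)^{k−2} is the principal branch.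 -/
section
open MeasureTheory Set Filter Topology Metric

lemma holo_param (F : ℂ → ℝ → ℂ) (μ : Measure ℝ) (z0 : ℂ) (R : ℝ) (hR : 0 < R) (b : ℝ → ℝ)
    (hb : Integrable b μ) (hmeas : ∀ z ∈ ball z0 R, AEStronglyMeasurable (F z) μ)
    (hd : ∀ᵐ x ∂μ, DifferentiableOn ℂ (fun z => F z x) (ball z0 R))
    (hbd : ∀ᵐ x ∂μ, ∀ z ∈ ball z0 R, ‖F z x‖ ≤ b x) :
    DifferentiableAt ℂ (fun z => ∫ x, F z x ∂μ) z0 := by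
  have hz0 : z0 ∈ ball z0 R := mem_ball_self hR
  have hR2 : 0 < R / 2 := by linarith
  have hR4 : 0 < R / 4 := by linarith
  have key := hasDerivAt_integral_of_dominated_loc_of_deriv_le (μ := μ) (𝕜 := ℂ) (E := ℂ)
    (F := F) (F' := fun z x => deriv (fun z => F z x) z) (x₀ := z0)
    (bound := fun x => b x / (R / 2)) (s := ball z0 (R / 2)) (ball_mem_nhds _ hR2)
    (by filter_upwards [ball_mem_nhds z0 hR] with z hz using hmeas z hz)
    (hb.mono' (hmeas z0 hz0) (by filter_upwards [hbd] with x hx using hx z0 hz0))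
    ?_ ?_ (hb.div_const _) ?_
  · exact key.2.differentiableAt
  · let ε : ℕ → ℂ := fun n => ((R / 2 * (1 / ((n : ℝ) + 1)) : ℝ) : ℂ)
    have hε0 : ∀ n, ε n ≠ 0 := by
      intro n
      simp only [ε, ne_eq, Complex.ofReal_eq_zero]
      positivity
    have hεt : Tendsto ε atTop (𝓝[≠] 0) := by
      rw [tendsto_nhdsWithin_iff]
      refine ⟨?_, Eventually.of_forall hε0⟩
      have : Tendsto (fun n : ℕ => (R / 2 * (1 / ((n : ℝ) + 1)) : ℝ)) atTop (𝓝 (R / 2 * 0)) :=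
        tendsto_one_div_add_atTop_nhds_zero_nat.const_mul _
      have h2 := (Complex.continuous_ofReal.tendsto _).comp this
      rw [mul_zero, Complex.ofReal_zero] at h2
      exact h2
    have hmem : ∀ n, z0 + ε n ∈ ball z0 R := by
      intro n
      simp only [mem_ball, dist_self_add_left, ε, Complex.norm_real, Real.norm_eq_abs]
      rw [abs_of_pos (by positivity)]
      have : 1 / ((n : ℝ) + 1) ≤ 1 := by
        rw [div_le_one (by positivity)]
        linarith [(Nat.cast_nonneg n : (0:ℝ) ≤ n)]
      nlinarith
    refine aestronglyMeasurable_of_tendsto_ae (u := atTop)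
      (f := fun n x => (ε n)⁻¹ • (F (z0 + ε n) x - F z0 x)) ?_ ?_
    · intro n
      exact ((hmeas _ (hmem n)).sub (hmeas _ hz0)).const_smul (ε n)⁻¹
    · filter_upwards [hd] with x hx
      have := (hx.differentiableAt (ball_mem_nhds z0 hR)).hasDerivAt
      exact this.tendsto_slope_zero.comp hεt
  · filter_upwards [hd, hbd] with x hx hbx z hz
    refine Complex.norm_deriv_le_of_forall_mem_sphere_norm_le hR2 ?_ ?_
    · refine (hx.mono ?_).diffContOnCl_ball (U := ball z0 R) ?_
      · exact fun _ h => h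
      · intro y hy
        rw [mem_ball] at *
        rw [mem_closedBall] at hy
        linarith [dist_triangle y z z0]
    · intro y hy
      apply hbx
      rw [mem_ball] at *
      rw [mem_sphere] at hy
      linarith [dist_triangle y z z0]
  · filter_upwards [hd] with x hx z hz
    exact (hx.differentiableAt (isOpen_ball.mem_nhds (ball_subset_ball (by linarith) hz))).hasDerivAt

lemma scale_const (S : Set ℂ) (hS : IsOpen S) (hc : Convex ℝ S) (h0 : (0:ℂ) ∉ S)
    (Φ : ℂ → ℂ) (hΦ : ∀ w ∈ S, DifferentiableAt ℂ Φ w)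
    (hinv : ∀ w ∈ S, ∀ r : ℝ, 0 < r → Φ ((r : ℂ) * w) = Φ w) {x y : ℂ} (hx : x ∈ S) (hy : y ∈ S) :
    Φ x = Φ y := by
  refine hS.is_const_of_deriv_eq_zero hc.isPreconnected
    (fun w hw => (hΦ w hw).differentiableWithinAt) ?_ hx hy
  intro w hw
  have h1 := (hΦ w hw).hasDerivAt
  have h2 : HasDerivAt (fun r : ℝ => (r : ℂ) * w) w 1 := by
    simpa using (Complex.ofRealCLM.hasDerivAt (x := (1:ℝ))).mul_const w
  have h3 : HasDerivAt (fun r : ℝ => Φ ((r : ℂ) * w)) (deriv Φ w * w) 1 := by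
    have h1' : HasDerivAt Φ (deriv Φ w) ((fun r : ℝ => (r : ℂ) * w) 1) := by simpa using h1
    exact h1'.comp (1:ℝ) h2
  have h4 : HasDerivAt (fun r : ℝ => Φ ((r : ℂ) * w)) 0 1 := by
    refine (hasDerivAt_const (1:ℝ) (Φ w)).congr_of_eventuallyEq ?_
    filter_upwards [lt_mem_nhds (show (0:ℝ) < 1 by norm_num)] with r hr using hinv w hw r hr
  have h5 := h3.unique h4
  rcases mul_eq_zero.1 h5 with h | h
  · exact h
  · exact absurd (h ▸ hw) h0

lemma int_a : IntegrableOn (fun x : ℝ => (x + 1) ^ (-2 : ℝ)) (Ioi 0) :=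
  integrableOn_add_rpow_Ioi_of_lt (by norm_num) (by norm_num)

lemma int_b : IntegrableOn (fun x : ℝ => |x - 1| ^ (-1/2 : ℝ) * (x + 1) ^ (-2 : ℝ)) (Ioi 0) := by
  have h0 : ∀ c d : ℝ, IntervalIntegrable (fun x : ℝ => |x| ^ (-1/2 : ℝ)) volume c d := by
    have hp : ∀ c : ℝ, 0 ≤ c → IntervalIntegrable (fun x : ℝ => |x| ^ (-1/2 : ℝ)) volume 0 c := by
      intro c hc
      refine (intervalIntegral.intervalIntegrable_rpow' (r := -1/2) (by norm_num)).congr ?_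
      intro x hx
      rw [uIoc_of_le hc] at hx
      simp [abs_of_pos hx.1]
    have hall : ∀ c : ℝ, IntervalIntegrable (fun x : ℝ => |x| ^ (-1/2 : ℝ)) volume 0 c := by
      intro c
      rcases le_total 0 c with h | h
      · exact hp c h
      · have := (hp (-c) (by linarith)).comp_sub_left 0
        simpa using this
    exact fun c d => (hall c).symm.trans (hall d)
  have h1 : IntegrableOn (fun x : ℝ => |x - 1| ^ (-1/2 : ℝ)) (Ioc 0 2) := by
    have := (h0 (-1) 1).comp_sub_right 1
    rw [intervalIntegrable_iff_integrableOn_Ioc_of_le (by norm_num)] at this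
    rw [show (-1:ℝ) + 1 = 0 by norm_num, show (1:ℝ) + 1 = 2 by norm_num] at this
    exact this
  have hm : Measurable (fun x : ℝ => |x - 1| ^ (-1/2 : ℝ) * (x + 1) ^ (-2 : ℝ)) := by fun_prop
  rw [← Ioc_union_Ioi_eq_Ioi (show (0:ℝ) ≤ 2 by norm_num)]
  refine IntegrableOn.union ?_ ?_
  · refine h1.mono' hm.aestronglyMeasurable ?_
    filter_upwards [ae_restrict_mem measurableSet_Ioc] with x hx
    rw [Real.norm_of_nonneg (by have := hx.1; positivity)]
    refine mul_le_of_le_one_right (by positivity) ?_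
    exact Real.rpow_le_one_of_one_le_of_nonpos (by linarith [hx.1]) (by norm_num)
  · refine (int_a.mono_set (Ioi_subset_Ioi (by norm_num : (0:ℝ) ≤ 2))).mono'
      hm.aestronglyMeasurable ?_
    filter_upwards [ae_restrict_mem measurableSet_Ioi] with x hx
    have hx' : 2 < x := hx
    rw [Real.norm_of_nonneg (by positivity)]
    refine mul_le_of_le_one_left (by positivity) ?_
    refine Real.rpow_le_one_of_one_le_of_nonpos ?_ (by norm_num)
    rw [abs_of_pos] <;> linarith

lemma bd_core (p : ℕ) (κ : ℝ) (hκ : κ = p - 1/2) (G0 t : ℂ) (B m T x : ℝ) (hB : 0 ≤ B)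
    (hx : 0 < x) (hm : 0 < m)
    (hG : ‖G0‖ ≤ B * (x + 1) ^ (-((p : ℝ) + 2))) (ht : m ≤ ‖t‖) (hT : ‖t‖ ≤ T * (x + 1)) :
    ‖G0 * t ^ (κ : ℂ)‖ ≤ B * T ^ p * (m ^ (-1/2 : ℝ) * (x + 1) ^ (-2 : ℝ)) := by
  have ht0 : 0 < ‖t‖ := lt_of_lt_of_le hm ht
  have hx1 : 0 < x + 1 := by linarith
  have hT0 : 0 ≤ T := by
    by_contra h
    push Not at h
    nlinarith
  rw [norm_mul, Complex.norm_cpow_real]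
  have h1 : ‖t‖ ^ κ = ‖t‖ ^ (-1/2 : ℝ) * ‖t‖ ^ p := by
    rw [← Real.rpow_natCast ‖t‖ p, ← Real.rpow_add ht0, hκ]
    congr 1
    ring
  have h2 : ‖t‖ ^ (-1/2 : ℝ) ≤ m ^ (-1/2 : ℝ) :=
    Real.rpow_le_rpow_of_nonpos hm ht (by norm_num)
  have h3 : ‖t‖ ^ p ≤ T ^ p * (x + 1) ^ p := by
    rw [← mul_pow]
    exact pow_le_pow_left₀ ht0.le hT p
  have h4 : (x + 1) ^ (-((p : ℝ) + 2)) * (x + 1) ^ p = (x + 1) ^ (-2 : ℝ) := by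
    rw [← Real.rpow_natCast (x + 1) p, ← Real.rpow_add hx1]
    congr 1
    ring
  calc ‖G0‖ * ‖t‖ ^ κ ≤ (B * (x + 1) ^ (-((p : ℝ) + 2))) * (m ^ (-1/2 : ℝ) * (T ^ p * (x + 1) ^ p)) := by
        rw [h1]
        gcongr
    _ = B * T ^ p * (m ^ (-1/2 : ℝ) * ((x + 1) ^ (-((p : ℝ) + 2)) * (x + 1) ^ p)) := by ring
    _ = _ := by rw [h4]

/-- decay hypothesis -/
def Decay (p : ℕ) (g : ℂ → ℂ) : Prop :=
  ∀ w0 : ℂ, 0 < w0.im → ∃ r > (0:ℝ), ∃ B ≥ (0:ℝ), ∀ w ∈ ball w0 r, 0 < w.im ∧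
    ∀ x : ℝ, 0 < x → ‖g (x * w)‖ ≤ B * (x + 1) ^ (-((p : ℝ) + 2))

lemma cont_ray (g : ℂ → ℂ) (hg : DifferentiableOn ℂ g {z : ℂ | 0 < z.im}) (w : ℂ) (hw : 0 < w.im) :
    ContinuousOn (fun x : ℝ => g ((x : ℂ) * w)) (Ioi 0) := by
  refine hg.continuousOn.comp (by fun_prop) ?_
  intro x hx
  have hx' : 0 < x := hx
  simp only [mem_ofPred_eq, Complex.im_ofReal_mul]
  positivity

lemma G_diff (p : ℕ) (κ : ℝ) (hκ : κ = p - 1/2) (g : ℂ → ℂ)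
    (hg : DifferentiableOn ℂ g {z : ℂ | 0 < z.im}) (hD : Decay p g) (u : ℂ)
    (hu : 0 < u.re ∨ u.im < 0) :
    DifferentiableAt ℂ (fun u : ℂ => ∫ y in Ioi (0:ℝ), g ((y : ℂ) * Complex.I) *
      ((y : ℂ) + Complex.I * u) ^ (κ : ℂ)) u := by
  obtain ⟨r, hr, B, hB, hgB⟩ := hD Complex.I (by simp)
  have hgB := (hgB Complex.I (mem_ball_self hr)).2
  obtain ⟨R, hR, hR1, hslit⟩ : ∃ R > (0:ℝ), R ≤ 1 ∧ ∃ m > (0:ℝ), ∀ v ∈ ball u R, ∀ y : ℝ, 0 < y →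
      (y : ℂ) + Complex.I * v ∈ Complex.slitPlane ∧ m ≤ ‖(y : ℂ) + Complex.I * v‖ := by
    rcases hu with hu | hu
    · refine ⟨min 1 (u.re / 2), by positivity, min_le_left _ _, u.re / 2, by positivity, ?_⟩
      intro v hv y hy
      have h1 : |v.re - u.re| < u.re / 2 := by
        have := Complex.abs_re_le_norm (v - u)
        rw [mem_ball, dist_eq_norm] at hv
        simp only [Complex.sub_re] at this
        exact lt_of_le_of_lt this (lt_of_lt_of_le hv (min_le_right _ _))
      have h2 : u.re / 2 < v.re := by
        have := (abs_lt.1 h1).1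
        linarith
      refine ⟨Or.inr ?_, ?_⟩
      · simp
        linarith
      · refine le_trans ?_ (Complex.abs_im_le_norm _)
        simp
        exact h2.le.trans (le_abs_self _)
    · refine ⟨min 1 (-u.im / 2), lt_min one_pos (by linarith), min_le_left _ _, -u.im / 2,
        by linarith, ?_⟩
      intro v hv y hy
      have h1 : |v.im - u.im| < -u.im / 2 := by
        have := Complex.abs_im_le_norm (v - u)
        rw [mem_ball, dist_eq_norm] at hv
        simp only [Complex.sub_im] at this
        exact lt_of_le_of_lt this (lt_of_lt_of_le hv (min_le_right _ _))
      have h2 : -u.im / 2 < - v.im := by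
        have := (abs_lt.1 h1).2
        linarith
      refine ⟨Or.inl ?_, ?_⟩
      · simp
        linarith
      · refine le_trans ?_ (Complex.re_le_norm _)
        simp
        linarith
  obtain ⟨m, hm, hslit⟩ := hslit
  refine holo_param _ (volume.restrict (Ioi 0)) u R hR
    (fun y => B * (2 + ‖u‖) ^ p * (m ^ (-1/2 : ℝ) * (y + 1) ^ (-2 : ℝ))) ?_ ?_ ?_ ?_
  · exact (int_a.const_mul _).const_mul _
  · intro v hv
    refine ContinuousOn.aestronglyMeasurable ?_ measurableSet_Ioi
    refine (cont_ray g hg _ (by simp)).mul ?_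
    refine ContinuousOn.cpow_const (by fun_prop) ?_
    intro y hy
    exact (hslit v hv y hy).1
  · filter_upwards [ae_restrict_mem measurableSet_Ioi] with y hy
    refine DifferentiableOn.const_mul ?_ _
    intro v hv
    refine DifferentiableAt.differentiableWithinAt ?_
    exact DifferentiableAt.cpow_const (by fun_prop) (hslit v hv y hy).1
  · filter_upwards [ae_restrict_mem measurableSet_Ioi] with y hy v hv
    have hy' : 0 < y := hy
    refine bd_core p κ hκ _ _ B m _ y hB hy hm (hgB y hy) (hslit v hv y hy).2 ?_
    refine (norm_add_le _ _).trans ?_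
    have h1 : ‖v‖ ≤ ‖u‖ + 1 := by
      rw [mem_ball, dist_eq_norm] at hv
      have := norm_le_norm_add_norm_sub' v u
      linarith
    simp only [Complex.norm_real, norm_mul, Complex.norm_I, one_mul]
    rw [Real.norm_of_nonneg hy'.le]
    nlinarith [norm_nonneg u]

noncomputable def Psi (κ : ℝ) (g : ℂ → ℂ) (u w : ℂ) : ℂ :=
  ∫ x in Ioi (0:ℝ), g ((x : ℂ) * w) * (-Complex.I * ((x : ℂ) * w - u)) ^ (κ : ℂ) * (-Complex.I * w)

lemma Psi_I (κ : ℝ) (g : ℂ → ℂ) (u : ℂ) : Psi κ g u Complex.I =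
    ∫ y in Ioi (0:ℝ), g ((y : ℂ) * Complex.I) * ((y : ℂ) + Complex.I * u) ^ (κ : ℂ) := by
  unfold Psi
  congr 1
  ext x
  have h1 : -Complex.I * ((x : ℂ) * Complex.I - u) = (x : ℂ) + Complex.I * u := by
    ring_nf
    simp
  rw [h1]
  simp

lemma slit_of (u w : ℂ) (hu : 0 < u.re) (hw : 0 < w.im * u.re - w.re * u.im) (x : ℝ) (hx : 0 < x) :
    -Complex.I * ((x : ℂ) * w - u) ∈ Complex.slitPlane := by
  rw [Complex.mem_slitPlane_iff]
  simp
  by_cases h : u.re - x * w.re = 0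
  · left
    have h1 : 0 < x * (w.im * u.re - w.re * u.im) := by positivity
    have h2 : x * (w.im * u.re - w.re * u.im) = (x * w.im - u.im) * u.re := by
      linear_combination (-u.im) * (-h)
    rw [h2] at h1
    have := (pos_iff_pos_of_mul_pos h1).2 hu
    linarith
  · right
    exact h

lemma Psi_const (p : ℕ) (κ : ℝ) (hκ : κ = p - 1/2) (g : ℂ → ℂ)
    (hg : DifferentiableOn ℂ g {z : ℂ | 0 < z.im}) (hD : Decay p g) (u : ℂ)
    (hu : 0 < u.re) (w : ℂ) (hw : 0 < w.im) (hw2 : 0 < w.im * u.re - w.re * u.im) :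
    Psi κ g u w = Psi κ g u Complex.I := by
  refine scale_const {w : ℂ | 0 < w.im ∧ 0 < w.im * u.re - w.re * u.im} ?_ ?_ ?_ (Psi κ g u)
    ?_ ?_ ⟨hw, hw2⟩ ⟨by simp, by simpa using hu⟩
  · refine IsOpen.inter ?_ ?_
    · exact isOpen_lt continuous_const Complex.continuous_im
    · exact isOpen_lt continuous_const
        (by fun_prop : Continuous fun w : ℂ => w.im * u.re - w.re * u.im)
  · intro a ha b hb s t hs ht hst
    obtain ⟨ha1, ha2⟩ := ha
    obtain ⟨hb1, hb2⟩ := hb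
    have aux : ∀ A B : ℝ, 0 < A → 0 < B → 0 < s * A + t * B := by
      intro A B hA hB
      rcases hs.eq_or_lt with h | h
      · have : t = 1 := by linarith
        rw [← h, this]
        linarith
      · have : 0 ≤ t * B := by positivity
        have : 0 < s * A := by positivity
        linarith
    refine ⟨?_, ?_⟩
    · simpa using aux _ _ ha1 hb1
    · have := aux _ _ ha2 hb2
      simp
      nlinarith
  · simp
  · intro w0 hw0
    obtain ⟨hw01, hw02⟩ := hw0
    obtain ⟨r, hr, B, hB, hgB⟩ := hD w0 hw01
    have hw0n : 0 < ‖w0‖ := by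
      rw [norm_pos_iff]
      rintro rfl
      simp at hw01
    set D : ℂ → ℝ := fun w => (w.im * u.re - w.re * u.im) with hDdef
    have hev : ∀ᶠ w in 𝓝 w0, D w0 / 2 < D w ∧ ‖w‖ < 2 * ‖w0‖ ∧ 0 < ‖w‖ := by
      have c1 : ContinuousAt D w0 := by
        simp only [hDdef]
        fun_prop
      have c2 : ContinuousAt (fun w : ℂ => ‖w‖) w0 := by fun_prop
      have hD0 : 0 < D w0 := hw02
      filter_upwards [c1.eventually (lt_mem_nhds (show D w0 / 2 < D w0 by linarith)),
        c2.eventually (gt_mem_nhds (show ‖w0‖ < 2 * ‖w0‖ by linarith)),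
        c2.eventually (lt_mem_nhds hw0n)] with w h1 h2 h3 using ⟨h1, h2, h3⟩
    obtain ⟨R, hR, hRb⟩ := Metric.eventually_nhds_iff_ball.1 hev
    have hD0 : 0 < D w0 := hw02
    set m : ℝ := D w0 / 2 / (2 * ‖w0‖) with hmdef
    have hm : 0 < m := by positivity
    refine holo_param _ (volume.restrict (Ioi 0)) w0 (min r R) (lt_min hr hR)
      (fun x => B * (2 * ‖w0‖ + ‖u‖) ^ p * (m ^ (-1/2 : ℝ) * (x + 1) ^ (-2 : ℝ)) * (2 * ‖w0‖)) ?_ ?_ ?_ ?_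
    · exact ((int_a.const_mul _).const_mul _).mul_const _
    · intro v hv
      have hv1 := hgB v (ball_subset_ball (min_le_left _ _) hv)
      have hv2 := hRb v (ball_subset_ball (min_le_right _ _) hv)
      refine ContinuousOn.aestronglyMeasurable ?_ measurableSet_Ioi
      refine ((cont_ray g hg _ hv1.1).mul ?_).mul continuousOn_const
      refine ContinuousOn.cpow_const (by fun_prop) ?_
      intro x hx
      exact slit_of u v hu (by have := hv2.1; simp only [hDdef] at *; linarith) x hx
    · filter_upwards [ae_restrict_mem measurableSet_Ioi] with x hx
      intro v hv
      have hv1 := hgB v (ball_subset_ball (min_le_left _ _) hv)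
      have hv2 := hRb v (ball_subset_ball (min_le_right _ _) hv)
      refine DifferentiableAt.differentiableWithinAt ?_
      refine ((?_ : DifferentiableAt ℂ _ _).mul ?_).mul (by fun_prop)
      · have hx' : 0 < x := hx
        have hmem : (x : ℂ) * v ∈ {z : ℂ | 0 < z.im} := by
          simp only [mem_ofPred_eq, Complex.im_ofReal_mul]
          have := hv1.1
          positivity
        have h1 : DifferentiableAt ℂ g ((x : ℂ) * v) :=
          hg.differentiableAt ((isOpen_lt continuous_const Complex.continuous_im).mem_nhds hmem)
        exact DifferentiableAt.comp (f := fun v : ℂ => (x : ℂ) * v) v h1 (by fun_prop)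
      · refine DifferentiableAt.cpow_const (by fun_prop) ?_
        exact slit_of u v hu (by have := hv2.1; simp only [hDdef] at *; linarith) x hx
    · filter_upwards [ae_restrict_mem measurableSet_Ioi] with x hx v hv
      have hx' : 0 < x := hx
      have hv1 := hgB v (ball_subset_ball (min_le_left _ _) hv)
      obtain ⟨hv2, hv3, hv4⟩ := hRb v (ball_subset_ball (min_le_right _ _) hv)
      rw [norm_mul]
      refine mul_le_mul ?_ ?_ (norm_nonneg _) (by positivity)
      · refine bd_core p κ hκ _ _ B m _ x hB hx hm (hv1.2 x hx) ?_ ?_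
        · have e1 : D v ≤ ‖(x : ℂ) * v - u‖ * ‖v‖ := by
            rw [← Complex.norm_conj v, ← norm_mul]
            refine le_trans ?_ (Complex.abs_im_le_norm _)
            refine le_trans (le_of_eq ?_) (le_abs_self _)
            simp [hDdef]
            ring
          have e2 : ‖-Complex.I * ((x : ℂ) * v - u)‖ = ‖(x : ℂ) * v - u‖ := by simp
          rw [e2, hmdef, div_le_iff₀ (by positivity)]
          have e3 : ‖(x : ℂ) * v - u‖ * ‖v‖ ≤ ‖(x : ℂ) * v - u‖ * (2 * ‖w0‖) := by gcongr
          linarith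
        · rw [norm_mul, norm_neg, Complex.norm_I, one_mul]
          refine (norm_sub_le _ _).trans ?_
          rw [norm_mul, Complex.norm_real, Real.norm_of_nonneg hx'.le]
          have : x * ‖v‖ ≤ x * (2 * ‖w0‖) := by gcongr
          nlinarith [norm_nonneg u, norm_nonneg w0]
      · simp
        exact hv3.le
  · intro v hv r hr
    unfold Psi
    have := integral_comp_mul_left_Ioi' (fun x : ℝ => g ((x : ℂ) * v) *
      (-Complex.I * ((x : ℂ) * v - u)) ^ (κ : ℂ) * (-Complex.I * v)) 0 hr
    rw [mul_zero] at this
    rw [← this, ← integral_smul]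
    congr 1
    ext x
    simp only [Complex.real_smul]
    push_cast
    have h1 : (x : ℂ) * ((r : ℂ) * v) = (r : ℂ) * x * v := by ring
    rw [h1]
    ring

lemma meas_core (κ : ℝ) (g : ℂ → ℂ)
    (hg : DifferentiableOn ℂ g {z : ℂ | 0 < z.im}) (u w : ℂ) (hw : 0 < w.im) :
    AEStronglyMeasurable (fun x : ℝ => g ((x : ℂ) * w) *
      (-Complex.I * ((x : ℂ) * w - u)) ^ (κ : ℂ) * (-Complex.I * w)) (volume.restrict (Ioi 0)) := by
  refine ((ContinuousOn.aestronglyMeasurable (cont_ray g hg w hw) measurableSet_Ioi).mul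
    ?_).mul aestronglyMeasurable_const
  exact Measurable.aestronglyMeasurable (by fun_prop)

lemma core (p : ℕ) (κ : ℝ) (hκ : κ = p - 1/2) (g : ℂ → ℂ)
    (hg : DifferentiableOn ℂ g {z : ℂ | 0 < z.im}) (hD : Decay p g) (w : ℂ)
    (hwr : 0 < w.re) (hw : 0 < w.im) :
    IntegrableOn (fun x : ℝ => g ((x : ℂ) * w) *
      (-Complex.I * ((x : ℂ) * w - w)) ^ (κ : ℂ) * (-Complex.I * w)) (Ioi 0) ∧
    Psi κ g w w = Psi κ g w Complex.I := by
  obtain ⟨r, hr, B, hB, hgB⟩ := hD w hw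
  have hgB := (hgB w (mem_ball_self hr)).2
  have hwn : 0 < ‖w‖ := by
    rw [norm_pos_iff]
    rintro rfl
    simp at hw
  have hne : ∀ᵐ x : ℝ ∂(volume.restrict (Ioi (0:ℝ))), x ≠ 1 :=
    ae_restrict_of_ae (by simp [ae_iff])
  have hbint : IntegrableOn (fun x : ℝ => B * (2 * ‖w‖) ^ p * ((‖w‖ * |x - 1|) ^ (-1/2 : ℝ) *
      (x + 1) ^ (-2 : ℝ)) * ‖w‖) (Ioi 0) := by
    refine Integrable.mul_const (Integrable.const_mul ?_ _) _
    have := int_b.const_mul (‖w‖ ^ (-1/2 : ℝ))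
    refine this.congr (Eventually.of_forall fun x => ?_)
    simp only
    rw [Real.mul_rpow hwn.le (abs_nonneg _)]
    ring
  have hbound : ∀ ε : ℝ, |ε| ≤ 1 → ∀ x : ℝ, 0 < x → x ≠ 1 →
      ‖g ((x : ℂ) * w) * (-Complex.I * ((x : ℂ) * w - w * (1 - ε * Complex.I))) ^ (κ : ℂ) *
        (-Complex.I * w)‖ ≤ B * (2 * ‖w‖) ^ p * ((‖w‖ * |x - 1|) ^ (-1/2 : ℝ) *
      (x + 1) ^ (-2 : ℝ)) * ‖w‖ := by
    intro ε hε x hx hx1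
    have hpos : 0 < |x - 1| := abs_pos.2 (sub_ne_zero.2 hx1)
    rw [norm_mul]
    refine mul_le_mul ?_ (by simp) (norm_nonneg _) (by positivity)
    have e : (x : ℂ) * w - w * (1 - ε * Complex.I) = w * (((x - 1 : ℝ) : ℂ) + ε * Complex.I) := by
      push_cast
      ring
    rw [e]
    refine bd_core p κ hκ _ _ B _ _ x hB hx (by positivity) (hgB x hx) ?_ ?_
    · rw [norm_mul, norm_mul, norm_neg, Complex.norm_I, one_mul]
      gcongr
      refine le_trans ?_ (Complex.abs_re_le_norm _)
      simp
    · rw [norm_mul, norm_mul, norm_neg, Complex.norm_I, one_mul]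
      have : ‖((x - 1 : ℝ) : ℂ) + ε * Complex.I‖ ≤ 2 * (x + 1) := by
        refine (norm_add_le _ _).trans ?_
        rw [norm_mul, Complex.norm_I, Complex.norm_real, Complex.norm_real, Real.norm_eq_abs,
          Real.norm_eq_abs, mul_one]
        have : |x - 1| ≤ x + 1 := by
          rw [abs_le]
          constructor <;> linarith
        linarith
      nlinarith
  refine ⟨?_, ?_⟩
  · refine hbint.mono' (meas_core κ g hg w w hw) ?_
    filter_upwards [hne, ae_restrict_mem measurableSet_Ioi] with x hx hx0
    have := hbound 0 (by simp) x hx0 hx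
    simpa using this
  · have hcu : Continuous (fun ε : ℝ => w * (1 - ε * Complex.I)) := by fun_prop
    have hu0 : Tendsto (fun ε : ℝ => w * (1 - ε * Complex.I)) (𝓝[>] 0) (𝓝 w) := by
      have := hcu.tendsto 0
      simp only [Complex.ofReal_zero, zero_mul, sub_zero, mul_one] at this
      exact this.mono_left nhdsWithin_le_nhds
    have hev : ∀ᶠ ε : ℝ in 𝓝[>] 0, 0 < ε ∧ ε ≤ 1 := by
      filter_upwards [Ioc_mem_nhdsGT (show (0:ℝ) < 1 by norm_num)] with ε hε using hε
    have t1 : Tendsto (fun ε : ℝ => Psi κ g (w * (1 - ε * Complex.I)) w) (𝓝[>] 0)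
        (𝓝 (Psi κ g w w)) := by
      unfold Psi
      refine tendsto_integral_filter_of_dominated_convergence _ ?_ ?_ hbint ?_
      · exact Eventually.of_forall fun ε => meas_core κ g hg _ w hw
      · filter_upwards [hev] with ε hε
        filter_upwards [hne, ae_restrict_mem measurableSet_Ioi] with x hx hx0
        exact hbound ε (by rw [abs_of_pos hε.1]; exact hε.2) x hx0 hx
      · filter_upwards [hne, ae_restrict_mem measurableSet_Ioi] with x hx hx0
        refine (Tendsto.const_mul _ ?_).mul_const _
        have hs : -Complex.I * ((x : ℂ) * w - w) ∈ Complex.slitPlane := by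
          refine Or.inr ?_
          simp
          have : w.re - x * w.re = (1 - x) * w.re := by ring
          rw [this]
          exact mul_ne_zero (sub_ne_zero.2 (Ne.symm hx)) hwr.ne'
        have hc : ContinuousAt (fun v : ℂ => (-Complex.I * ((x : ℂ) * w - v)) ^ (κ : ℂ)) w :=
          ContinuousAt.cpow (by fun_prop) (by fun_prop) hs
        exact hc.tendsto.comp hu0
    have t2 : Tendsto (fun ε : ℝ => Psi κ g (w * (1 - ε * Complex.I)) Complex.I) (𝓝[>] 0)
        (𝓝 (Psi κ g w Complex.I)) := by
      simp only [Psi_I]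
      exact (G_diff p κ hκ g hg hD w (Or.inl hwr)).continuousAt.tendsto.comp hu0
    refine tendsto_nhds_unique t1 (t2.congr' ?_)
    filter_upwards [hev] with ε hε
    have hε0 := hε.1
    refine (Psi_const p κ hκ g hg hD _ ?_ w hw ?_).symm
    · simp
      nlinarith [mul_pos hε0 hw]
    · simp
      nlinarith [mul_pos hε0 hw, mul_pos (mul_pos hε0 hw) hw, mul_pos (mul_pos hε0 hwr) hwr]

lemma rmul_cpow (r : ℝ) (hr : 0 < r) (z : ℂ) (hz : z ≠ 0) (κ : ℝ) :
    ((r : ℂ) * z) ^ (κ : ℂ) = ((r ^ κ : ℝ) : ℂ) * z ^ (κ : ℂ) := by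
  have hr0 : (r : ℂ) ≠ 0 := by exact_mod_cast hr.ne'
  rw [Complex.cpow_def_of_ne_zero (mul_ne_zero hr0 hz), Complex.log_ofReal_mul hr hz, add_mul,
    Complex.exp_add, Complex.cpow_def_of_ne_zero hz, Real.rpow_def_of_pos hr]
  push_cast
  rfl

lemma norm_term (ν : ℝ) (u : ℂ) (s : ℝ) :
    ‖Complex.exp (Complex.I * ν * (s * u))‖ = Real.exp (-(ν * u.im * s)) := by
  rw [Complex.norm_exp]
  congr 1
  simp
  ring

lemma mono_norm (κ ν : ℝ) (u : ℂ) (s : ℝ) (hs : 0 < s) :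
    ‖Complex.exp (Complex.I * ν * (s * u)) * (-Complex.I * (s * u)) ^ (κ : ℂ) * (-Complex.I * u)‖
      = ‖u‖ ^ κ * ‖u‖ * (s ^ κ * Real.exp (-(ν * u.im * s))) := by
  rw [norm_mul, norm_mul, norm_term, Complex.norm_cpow_real]
  simp only [norm_mul, norm_neg, Complex.norm_I, one_mul, Complex.norm_real]
  rw [Real.norm_of_nonneg hs.le, Real.mul_rpow hs.le (norm_nonneg _)]
  ring

lemma mono_slit (u : ℂ) (s : ℝ) (hs : 0 < s) (hu : 0 < u.im) :
    -Complex.I * (s * u) ∈ Complex.slitPlane := by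
  refine Or.inl ?_
  simp
  positivity

lemma int_gam (κ c : ℝ) (hκ : -1 < κ) (hc : 0 < c) :
    IntegrableOn (fun s : ℝ => s ^ κ * Real.exp (-(c * s))) (Ioi 0) := by
  have := integrableOn_rpow_mul_exp_neg_mul_rpow hκ (p := 1) one_pos hc
  simpa using this

lemma mono_meas (κ ν : ℝ) (u : ℂ) :
    Measurable (fun s : ℝ => Complex.exp (Complex.I * ν * (s * u)) *
      (-Complex.I * (s * u)) ^ (κ : ℂ) * (-Complex.I * u)) := by
  fun_prop

lemma mono_int (κ ν : ℝ) (hκ : -1 < κ) (hν : 0 < ν) (u : ℂ) (hu : 0 < u.im) :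
    ∫ s in Ioi (0:ℝ), Complex.exp (Complex.I * ν * (s * u)) *
      (-Complex.I * (s * u)) ^ (κ : ℂ) * (-Complex.I * u) =
      (((1 / ν) ^ (κ + 1) * Real.Gamma (κ + 1) : ℝ) : ℂ) := by
  have hI : ∫ s in Ioi (0:ℝ), Complex.exp (Complex.I * ν * (s * Complex.I)) *
      (-Complex.I * (s * Complex.I)) ^ (κ : ℂ) * (-Complex.I * Complex.I) =
      (((1 / ν) ^ (κ + 1) * Real.Gamma (κ + 1) : ℝ) : ℂ) := by
    rw [← Real.integral_rpow_mul_exp_neg_mul_Ioi (by linarith) hν, ← integral_complex_ofReal]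
    refine setIntegral_congr_fun measurableSet_Ioi ?_
    intro s hs
    have hs' : 0 < s := hs
    have e1 : Complex.I * ν * (s * Complex.I) = ((-(ν * s) : ℝ) : ℂ) := by
      push_cast
      linear_combination ((ν : ℂ) * s) * Complex.I_mul_I
    have e2 : -Complex.I * (s * Complex.I) = (s : ℂ) := by
      linear_combination (-(s : ℂ)) * Complex.I_mul_I
    simp only [e1, e2]
    rw [← Complex.ofReal_exp, ← Complex.ofReal_cpow hs'.le]
    simp [mul_comm]
  rw [← hI]
  refine scale_const {w : ℂ | 0 < w.im} (isOpen_lt continuous_const Complex.continuous_im)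
    (convex_halfSpace_im_gt 0) (by simp)
    (fun u => ∫ s in Ioi (0:ℝ), Complex.exp (Complex.I * ν * (s * u)) *
      (-Complex.I * (s * u)) ^ (κ : ℂ) * (-Complex.I * u)) ?_ ?_ hu
    (show Complex.I ∈ {w : ℂ | 0 < w.im} by simp)
  · intro w0 hw0
    have hw0 : 0 < w0.im := hw0
    have hw0n : w0 ≠ 0 := by
      rintro rfl
      simp at hw0
    have hev : ∀ᶠ w in 𝓝 w0, w0.im / 2 < w.im ∧ ‖w‖ ^ κ * ‖w‖ < ‖w0‖ ^ κ * ‖w0‖ + 1 := by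
      have c2 : ContinuousAt (fun w : ℂ => ‖w‖ ^ κ * ‖w‖) w0 := by
        refine ContinuousAt.mul ?_ (by fun_prop)
        exact ContinuousAt.rpow_const (by fun_prop) (Or.inl (norm_ne_zero_iff.2 hw0n))
      filter_upwards [Complex.continuous_im.continuousAt.eventually
        (lt_mem_nhds (show w0.im / 2 < w0.im by linarith)),
        c2.eventually (gt_mem_nhds (show _ < ‖w0‖ ^ κ * ‖w0‖ + 1 by linarith))] with w h1 h2
      exact ⟨h1, h2⟩
    obtain ⟨R, hR, hRb⟩ := Metric.eventually_nhds_iff_ball.1 hev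
    refine holo_param _ (volume.restrict (Ioi 0)) w0 R hR
      (fun s => (‖w0‖ ^ κ * ‖w0‖ + 1) * (s ^ κ * Real.exp (-(ν * (w0.im / 2) * s)))) ?_ ?_ ?_ ?_
    · exact (int_gam κ _ hκ (by positivity)).const_mul _
    · intro v hv
      exact (mono_meas κ ν v).aestronglyMeasurable
    · filter_upwards [ae_restrict_mem measurableSet_Ioi] with s hs v hv
      have hv0 : 0 < v.im := by linarith [(hRb v hv).1]
      refine DifferentiableAt.differentiableWithinAt ?_
      refine ((by fun_prop : DifferentiableAt ℂ _ _).mul ?_).mul (by fun_prop)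
      exact DifferentiableAt.cpow_const (by fun_prop) (mono_slit v s hs hv0)
    · filter_upwards [ae_restrict_mem measurableSet_Ioi] with s hs v hv
      have hs' : 0 < s := hs
      obtain ⟨h1, h2⟩ := hRb v hv
      rw [mono_norm κ ν v s hs']
      gcongr
  · intro v hv r hr
    have := integral_comp_mul_left_Ioi' (fun s : ℝ => Complex.exp (Complex.I * ν * (s * v)) *
      (-Complex.I * (s * v)) ^ (κ : ℂ) * (-Complex.I * v)) 0 hr
    rw [mul_zero] at this
    rw [← this, ← integral_smul]
    congr 1
    ext x
    simp only [Complex.real_smul]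
    push_cast
    have h1 : (x : ℂ) * ((r : ℂ) * v) = (r : ℂ) * x * v := by ring
    rw [h1]
    ring

lemma summ_exp (σ c : ℝ) (hc : 0 < c) :
    Summable (fun n : ℕ => ((n + 1 : ℕ) : ℝ) ^ σ * Real.exp (-(c * ((n + 1 : ℕ) : ℝ)))) := by
  have h := Real.summable_pow_mul_exp_neg_nat_mul ⌈σ⌉₊ hc
  have h1 := (summable_nat_add_iff 1).2 h
  refine Summable.of_nonneg_of_le (fun n => by positivity) (fun n => ?_) h1
  rw [neg_mul]
  gcongr
  rw [← Real.rpow_natCast]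
  exact Real.rpow_le_rpow_of_exponent_le (by simp) (Nat.le_ceil _)

lemma norm_q (n : ℕ) (z : ℂ) :
    ‖Complex.exp (2 * Real.pi * Complex.I * ((n : ℂ) + 1) * z)‖ =
      Real.exp (-(2 * Real.pi * z.im * ((n + 1 : ℕ) : ℝ))) := by
  rw [Complex.norm_exp]
  congr 1
  simp
  ring

lemma eich_int (k : ℝ) (hk : 1 < k) (f : ℂ → ℂ)
    (a : ℕ → ℂ) (C σ : ℝ) (hC : 0 < C)
    (hbound : ∀ n : ℕ, ‖a (n + 1)‖ ≤ C * ((n + 1 : ℕ) : ℝ) ^ σ)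
    (hf_four : ∀ z : ℂ, 0 < z.im →
      f z = ∑' n : ℕ, a (n + 1) *
        Complex.exp (2 * Real.pi * Complex.I * ((n : ℂ) + 1) * z)) (z u : ℂ) (hz : 0 < z.im)
    (hu : 0 < u.im) :
    (∑' n : ℕ, a (n + 1) * ((n + 1 : ℕ) : ℂ) ^ ((1 : ℂ) - (k : ℂ)) *
              Complex.exp (2 * Real.pi * Complex.I * ((n : ℂ) + 1) * z)) =
    (((2 * Real.pi) ^ (k - 1) / Real.Gamma (k - 1) : ℝ) : ℂ) *
      ∫ s in Ioi (0:ℝ), f (z + s * u) * (-Complex.I * (s * u)) ^ ((k - 2 : ℝ) : ℂ) *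
        (-Complex.I * u) := by
  have hpi := Real.pi_pos
  set ν : ℕ → ℝ := fun n => 2 * Real.pi * ((n + 1 : ℕ) : ℝ) with hν
  have hν0 : ∀ n, 0 < ν n := fun n => by simp only [hν]; positivity
  set F : ℕ → ℝ → ℂ := fun n s => (a (n + 1) *
    Complex.exp (2 * Real.pi * Complex.I * ((n : ℂ) + 1) * z)) *
    (Complex.exp (Complex.I * ν n * (s * u)) * (-Complex.I * (s * u)) ^ ((k - 2 : ℝ) : ℂ) *
      (-Complex.I * u)) with hF
  have hnorm : ∀ n, ∀ s ∈ Ioi (0:ℝ), ‖F n s‖ = (‖a (n + 1)‖ *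
      Real.exp (-(2 * Real.pi * z.im * ((n + 1 : ℕ) : ℝ)))) * (‖u‖ ^ (k - 2) * ‖u‖ *
      (s ^ (k - 2) * Real.exp (-(ν n * u.im * s)))) := by
    intro n s hs
    simp only [hF]
    rw [norm_mul, mono_norm _ _ u s hs, norm_mul, norm_q]
  have hmeas : ∀ n, Measurable (F n) := fun n => (mono_meas _ _ u).const_mul _
  have hint : ∀ n, Integrable (F n) (volume.restrict (Ioi 0)) := by
    intro n
    refine Integrable.mono' (((int_gam (k - 2) (ν n * u.im) (by linarith)
      (mul_pos (hν0 n) hu)).const_mul (‖u‖ ^ (k - 2) * ‖u‖)).const_mul (‖a (n + 1)‖ *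
      Real.exp (-(2 * Real.pi * z.im * ((n + 1 : ℕ) : ℝ))))) (hmeas n).aestronglyMeasurable ?_
    filter_upwards [ae_restrict_mem measurableSet_Ioi] with s hs
    exact (hnorm n s hs).le
  have hnint : ∀ n, ∫ s in Ioi (0:ℝ), ‖F n s‖ = (‖a (n + 1)‖ *
      Real.exp (-(2 * Real.pi * z.im * ((n + 1 : ℕ) : ℝ)))) * (‖u‖ ^ (k - 2) * ‖u‖ *
      ((1 / (ν n * u.im)) ^ (k - 1) * Real.Gamma (k - 1))) := by
    intro n
    rw [setIntegral_congr_fun measurableSet_Ioi (hnorm n), integral_const_mul, integral_const_mul,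
      ← Real.integral_rpow_mul_exp_neg_mul_Ioi (by linarith) (mul_pos (hν0 n) hu)]
    congr 4
    ext s
    congr 2
    ring
  have hsum : Summable fun n => ∫ s in Ioi (0:ℝ), ‖F n s‖ := by
    have h1 := ((summ_exp σ (2 * Real.pi * z.im) (by positivity)).mul_left C).mul_right
      (‖u‖ ^ (k - 2) * ‖u‖ * ((1 / (2 * Real.pi * u.im)) ^ (k - 1) * Real.Gamma (k - 1)))
    have hG : 0 < Real.Gamma (k - 1) := Real.Gamma_pos_of_pos (by linarith)
    refine Summable.of_nonneg_of_le (fun n => by positivity) (fun n => ?_) h1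
    rw [hnint, ← mul_assoc C]
    have hνu : 0 < ν n * u.im := mul_pos (hν0 n) hu
    have h2 : 2 * Real.pi * u.im ≤ ν n * u.im := by
      simp only [hν]
      have : (1:ℝ) ≤ ((n + 1 : ℕ) : ℝ) := by simp
      have h3 : 2 * Real.pi * 1 ≤ 2 * Real.pi * ((n + 1 : ℕ) : ℝ) := by gcongr
      nlinarith
    have h4 : (1 / (ν n * u.im)) ^ (k - 1) ≤ (1 / (2 * Real.pi * u.im)) ^ (k - 1) := by
      refine Real.rpow_le_rpow (by positivity) ?_ (by linarith)
      gcongr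
    have := hbound n
    gcongr
  have key := hasSum_integral_of_summable_integral_norm hint hsum
  have hR : ∫ s in Ioi (0:ℝ), (∑' n, F n s) = ∫ s in Ioi (0:ℝ), f (z + s * u) *
      (-Complex.I * (s * u)) ^ ((k - 2 : ℝ) : ℂ) * (-Complex.I * u) := by
    refine setIntegral_congr_fun measurableSet_Ioi ?_
    intro s hs
    have hs' : 0 < s := hs
    simp only
    rw [hf_four (z + s * u) (by simp; positivity), mul_assoc, ← tsum_mul_right]
    congr 1
    ext n
    simp only [hF]
    have : Complex.exp (2 * Real.pi * Complex.I * ((n : ℂ) + 1) * (z + s * u)) =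
        Complex.exp (2 * Real.pi * Complex.I * ((n : ℂ) + 1) * z) *
        Complex.exp (Complex.I * ν n * (s * u)) := by
      rw [← Complex.exp_add]
      congr 1
      simp only [hν]
      push_cast
      ring
    rw [this]
    ring
  rw [← hR, ← key.tsum_eq, ← tsum_mul_left]
  congr 1
  ext n
  simp only [hF]
  rw [integral_const_mul, mono_int _ _ (by linarith) (hν0 n) u hu]
  have hG : 0 < Real.Gamma (k - 1) := Real.Gamma_pos_of_pos (by linarith)
  have e1 : ((n + 1 : ℕ) : ℂ) ^ ((1 : ℂ) - (k : ℂ)) = (((((n + 1 : ℕ) : ℝ)) ^ (1 - k) : ℝ) : ℂ) := by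
    rw [Complex.ofReal_cpow (by positivity)]
    push_cast
    rfl
  have e2 : ((n + 1 : ℕ) : ℝ) ^ (1 - k) = (2 * Real.pi) ^ (k - 1) / Real.Gamma (k - 1) *
      ((1 / ν n) ^ (k - 2 + 1) * Real.Gamma (k - 2 + 1)) := by
    have : k - 2 + 1 = k - 1 := by ring
    rw [this]
    simp only [hν]
    rw [one_div, Real.inv_rpow (by positivity), Real.mul_rpow (x := 2 * Real.pi) (y := ((n + 1 : ℕ) : ℝ)) (by positivity) (by positivity),
      show 1 - k = -(k - 1) by ring, Real.rpow_neg (by positivity)]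
    have : (2 * Real.pi) ^ (k - 1) ≠ 0 := by positivity
    field_simp
  rw [e1, e2]
  push_cast
  ring

lemma eich_diff (k : ℝ) (hk : 1 < k)
    (a : ℕ → ℂ) (C σ : ℝ) (hC : 0 < C)
    (hbound : ∀ n : ℕ, ‖a (n + 1)‖ ≤ C * ((n + 1 : ℕ) : ℝ) ^ σ) (z : ℂ) (hz : 0 < z.im) :
    DifferentiableAt ℂ (fun z : ℂ => ∑' n : ℕ, a (n + 1) * ((n + 1 : ℕ) : ℂ) ^ ((1 : ℂ) - (k : ℂ)) *
              Complex.exp (2 * Real.pi * Complex.I * ((n : ℂ) + 1) * z)) z := by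
  have hpi := Real.pi_pos
  have hopen : IsOpen {w : ℂ | z.im / 2 < w.im} :=
    isOpen_lt continuous_const Complex.continuous_im
  have := Complex.differentiableOn_tsum_of_summable_norm
    (F := fun (n : ℕ) (z : ℂ) => a (n + 1) * ((n + 1 : ℕ) : ℂ) ^ ((1 : ℂ) - (k : ℂ)) *
              Complex.exp (2 * Real.pi * Complex.I * ((n : ℂ) + 1) * z))
    (U := {w : ℂ | z.im / 2 < w.im})
    ((summ_exp σ (2 * Real.pi * (z.im / 2)) (by positivity)).mul_left C) ?_ hopen ?_
  · exact this.differentiableAt (hopen.mem_nhds (by simp; linarith))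
  · intro n
    fun_prop
  · intro n w hw
    have hw' : z.im / 2 < w.im := hw
    rw [norm_mul, norm_mul, norm_q, ← mul_assoc]
    have e1 : ‖((n + 1 : ℕ) : ℂ) ^ ((1 : ℂ) - (k : ℂ))‖ ≤ 1 := by
      have : ((1 : ℂ) - (k : ℂ)) = ((1 - k : ℝ) : ℂ) := by push_cast; rfl
      rw [this, Complex.norm_cpow_real]
      refine Real.rpow_le_one_of_one_le_of_nonpos ?_ (by linarith)
      rw [Complex.norm_natCast]
      simp
    have e2 := hbound n
    have e3 : ‖a (n + 1)‖ * ‖((n + 1 : ℕ) : ℂ) ^ ((1 : ℂ) - (k : ℂ))‖ ≤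
        C * ((n + 1 : ℕ) : ℝ) ^ σ := by
      calc _ ≤ ‖a (n + 1)‖ * 1 := by gcongr
        _ ≤ _ := by rw [mul_one]; exact e2
    gcongr

lemma f_bound (f : ℂ → ℂ)
    (a : ℕ → ℂ) (C σ : ℝ) (hC : 0 < C)
    (hbound : ∀ n : ℕ, ‖a (n + 1)‖ ≤ C * ((n + 1 : ℕ) : ℝ) ^ σ)
    (hf_four : ∀ z : ℂ, 0 < z.im →
      f z = ∑' n : ℕ, a (n + 1) *
        Complex.exp (2 * Real.pi * Complex.I * ((n : ℂ) + 1) * z)) (m : ℕ) (hm : σ + 1 < m) :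
    ∃ M ≥ (0:ℝ), ∀ z : ℂ, 0 < z.im → ‖f z‖ ≤ M / z.im ^ m := by
  have hpi := Real.pi_gt_three
  have hs : Summable (fun n : ℕ => ((n + 1 : ℕ) : ℝ) ^ (σ - m)) :=
    (summable_nat_add_iff 1).2 (Real.summable_nat_rpow.2 (by linarith))
  refine ⟨C * m.factorial * ∑' n : ℕ, ((n + 1 : ℕ) : ℝ) ^ (σ - m), ?_, ?_⟩
  · have : 0 ≤ ∑' n : ℕ, ((n + 1 : ℕ) : ℝ) ^ (σ - m) := tsum_nonneg fun n => by positivity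
    positivity
  · intro z hz
    rw [hf_four z hz]
    have hs2 := (hs.mul_left (C * m.factorial)).div_const (z.im ^ m)
    refine (tsum_of_norm_bounded hs2.hasSum ?_).trans (le_of_eq ?_)
    · intro n
      rw [norm_mul, norm_q]
      set N : ℝ := ((n + 1 : ℕ) : ℝ) with hN
      have hN1 : 0 < N := by positivity
      have h1 : Real.exp (-(2 * Real.pi * z.im * N)) ≤ m.factorial / (z.im * N) ^ m := by
        have h2 := Real.pow_div_factorial_le_exp (z.im * N) (by positivity) m
        have h3 : Real.exp (z.im * N) ≤ Real.exp (2 * Real.pi * z.im * N) := by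
          apply Real.exp_le_exp.2
          have : 0 < z.im * N := by positivity
          nlinarith
        rw [Real.exp_neg, ← inv_div]
        gcongr
        exact h2.trans h3
      calc ‖a (n + 1)‖ * Real.exp (-(2 * Real.pi * z.im * N))
          ≤ (C * N ^ σ) * (m.factorial / (z.im * N) ^ m) := by
            gcongr
            exact hbound n
        _ = _ := by
            rw [Real.rpow_sub hN1, Real.rpow_natCast, mul_pow]
            field_simp
    · rw [tsum_div_const, tsum_mul_left]

lemma im_neg_inv (c α : ℝ) (v : ℂ) :
    ((α : ℂ) - 1 / ((c : ℂ) ^ 2 * v)).im = v.im / (c ^ 2 * ‖v‖ ^ 2) := by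
  have h1 : (1 : ℂ) / ((c : ℂ) ^ 2 * v) = (((c ^ 2)⁻¹ : ℝ) : ℂ) * v⁻¹ := by
    push_cast
    rw [one_div, mul_inv]
  rw [h1, Complex.sub_im, Complex.im_ofReal_mul, Complex.inv_im, Complex.normSq_eq_norm_sq]
  simp only [Complex.ofReal_im]
  rw [div_eq_mul_inv, div_eq_mul_inv, mul_inv]
  ring

lemma decay_g (p : ℕ) (k σ c α δ : ℝ) (hc : 0 < c) (f : ℂ → ℂ) (J : ℂ) (hJ : ‖J‖ = 1)
    (hfb : ∀ m : ℕ, σ + 1 < m → ∃ M ≥ (0:ℝ), ∀ z : ℂ, 0 < z.im → ‖f z‖ ≤ M / z.im ^ m)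
    (htr : ∀ v : ℂ, 0 < v.im →
      f ((α : ℂ) - 1 / ((c : ℂ) ^ 2 * v)) = J * ((c : ℂ) * v) ^ (k : ℂ) * f (v - δ)) :
    Decay p (fun v => f (v - δ)) := by
  intro w0 hw0
  obtain ⟨m, hm⟩ := exists_nat_gt (max (max (σ + 1) (p + 2)) (max k 0))
  have hm1 : σ + 1 < m := lt_of_le_of_lt ((le_max_left _ _).trans (le_max_left _ _)) hm
  have hm2 : (p : ℝ) + 2 < m := lt_of_le_of_lt ((le_max_right _ _).trans (le_max_left _ _)) hm
  have hm3 : k < m := lt_of_le_of_lt ((le_max_left _ _).trans (le_max_right _ _)) hm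
  have hm4 : (0:ℝ) ≤ m := by positivity
  obtain ⟨M, hM, hfM⟩ := hfb m hm1
  set h : ℝ := w0.im / 2 with hh
  have hh0 : 0 < h := by positivity
  set L : ℝ := ‖w0‖ + h with hL
  have hL0 : 0 < L := by positivity
  set B1 : ℝ := M * (2 / h) ^ m with hB1
  set B2 : ℝ := M * (c * L) ^ (2 * (m:ℝ) - k) / h ^ m * 2 ^ ((p : ℝ) + 2) with hB2
  have hB10 : 0 ≤ B1 := by positivity
  have hB20 : 0 ≤ B2 := by positivity
  refine ⟨h, hh0, B1 + B2, by positivity, ?_⟩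
  intro w hw
  rw [mem_ball, dist_eq_norm] at hw
  have him : h < w.im := by
    have h1 := (Complex.abs_im_le_norm (w - w0)).trans_lt hw
    rw [Complex.sub_im] at h1
    have := (abs_lt.1 h1).1
    linarith
  have hwim : 0 < w.im := hh0.trans him
  have hwL : ‖w‖ ≤ L := by
    have := norm_le_norm_add_norm_sub' w w0
    linarith
  have hwn : 0 < ‖w‖ := by
    rw [norm_pos_iff]
    rintro rfl
    simp at hwim
  refine ⟨hwim, ?_⟩
  intro x hx
  have hx1 : 0 < x + 1 := by linarith
  have hpw : 0 < (x + 1) ^ (-((p : ℝ) + 2)) := by positivity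
  have hvim : ((x : ℂ) * w).im = x * w.im := by simp
  have hvim0 : 0 < ((x : ℂ) * w).im := by rw [hvim]; positivity
  rw [add_mul]
  rcases le_total 1 x with hx' | hx'
  · have h1 : ‖f ((x : ℂ) * w - δ)‖ ≤ M / (x * w.im) ^ m := by
      have := hfM ((x : ℂ) * w - δ) (by simpa using by positivity)
      simpa using this
    have h2 : M / (x * w.im) ^ m ≤ B1 * (x + 1) ^ (-((p : ℝ) + 2)) := by
      calc M / (x * w.im) ^ m ≤ M / ((x + 1) / 2 * h) ^ m := by
            gcongr
            linarith
        _ = B1 * (x + 1) ^ (-(m : ℝ)) := by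
            rw [hB1, Real.rpow_neg hx1.le, Real.rpow_natCast]
            rw [div_pow, mul_pow, div_pow]
            field_simp
        _ ≤ _ := by
            refine mul_le_mul_of_nonneg_left ?_ hB10
            exact Real.rpow_le_rpow_of_exponent_le (by linarith) (by linarith)
    have h3 : 0 ≤ B2 * (x + 1) ^ (-((p : ℝ) + 2)) := by positivity
    linarith
  · have h1 := htr ((x : ℂ) * w) hvim0
    have h2a : (0:ℝ) < ((α : ℂ) - 1 / ((c : ℂ) ^ 2 * ((x : ℂ) * w))).im := by
      rw [im_neg_inv, hvim, norm_mul, Complex.norm_real, Real.norm_of_nonneg hx.le]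
      positivity
    have h2 := hfM _ h2a
    rw [im_neg_inv, hvim, h1, norm_mul, norm_mul, hJ, one_mul, Complex.norm_cpow_real] at h2
    simp only [norm_mul, Complex.norm_real] at h2
    rw [Real.norm_of_nonneg hx.le, Real.norm_of_nonneg hc.le] at h2
    set q : ℝ := c * (x * ‖w‖) with hq
    have hq0 : 0 < q := by positivity
    have hqk : 0 < q ^ k := by positivity
    have e1 : M / (x * w.im / (c ^ 2 * (x * ‖w‖) ^ 2)) ^ m =
        M * (q ^ (2 * (m : ℝ) - k) / (x * w.im) ^ m) * q ^ k := by
      rw [Real.rpow_sub hq0, Real.rpow_mul hq0.le, Real.rpow_natCast, Real.rpow_two, div_pow,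
        ← mul_pow c, ← hq]
      field_simp
    rw [e1, mul_comm (q ^ k)] at h2
    have h3 := le_of_mul_le_mul_right h2 hqk
    have e2 : q ^ (2 * (m : ℝ) - k) / (x * w.im) ^ m ≤ (c * L) ^ (2 * (m:ℝ) - k) / h ^ m := by
      calc q ^ (2 * (m : ℝ) - k) / (x * w.im) ^ m
          ≤ (x * (c * L)) ^ (2 * (m : ℝ) - k) / (x * h) ^ m := by
            gcongr
            · linarith
            · rw [hq]
              calc c * (x * ‖w‖) = x * (c * ‖w‖) := by ring
                _ ≤ _ := by gcongr
        _ = x ^ ((m : ℝ) - k) * ((c * L) ^ (2 * (m:ℝ) - k) / h ^ m) := by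
            rw [Real.mul_rpow hx.le (by positivity), mul_pow,
              show (2 * (m:ℝ) - k) = (m : ℝ) + ((m : ℝ) - k) by ring, Real.rpow_add hx,
              Real.rpow_natCast]
            field_simp
        _ ≤ 1 * ((c * L) ^ (2 * (m:ℝ) - k) / h ^ m) := by
            gcongr
            exact Real.rpow_le_one hx.le hx' (by linarith)
        _ = _ := one_mul _
    have e3 : (1:ℝ) ≤ 2 ^ ((p : ℝ) + 2) * (x + 1) ^ (-((p : ℝ) + 2)) := by
      rw [Real.rpow_neg hx1.le, ← div_eq_mul_inv, le_div_iff₀ (by positivity), one_mul]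
      refine Real.rpow_le_rpow hx1.le (by linarith) (by positivity)
    have h4 : ‖f ((x : ℂ) * w - δ)‖ ≤ B2 * (x + 1) ^ (-((p : ℝ) + 2)) := by
      refine h3.trans ?_
      calc M * (q ^ (2 * (m : ℝ) - k) / (x * w.im) ^ m)
          ≤ M * ((c * L) ^ (2 * (m:ℝ) - k) / h ^ m) * 1 := by
            rw [mul_one]
            gcongr
        _ ≤ M * ((c * L) ^ (2 * (m:ℝ) - k) / h ^ m) *
            (2 ^ ((p : ℝ) + 2) * (x + 1) ^ (-((p : ℝ) + 2))) := by
            gcongr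
        _ = _ := by rw [hB2]; ring
    have h5 : 0 ≤ B1 * (x + 1) ^ (-((p : ℝ) + 2)) := by positivity
    simp only
    linarith

lemma branch (κ : ℝ) (u : ℂ) (hr : 0 < u.re) (hi : 0 < u.im) :
    u ^ (κ : ℂ) * u ^ (κ : ℂ) * (Complex.I / u) ^ (κ : ℂ) = (Complex.I * u) ^ (κ : ℂ) := by
  have hpi := Real.pi_pos
  have hu : u ≠ 0 := by
    rintro rfl
    simp at hr
  have ha1 : u.arg < Real.pi / 2 := Complex.arg_lt_pi_div_two_iff.2 (Or.inl hr)
  have ha0 : 0 ≤ u.arg := Complex.arg_nonneg_iff.2 hi.le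
  have hne : u.arg ≠ Real.pi := by linarith
  have l1 : Complex.log (Complex.I * u) = Complex.log Complex.I + Complex.log u := by
    refine (Complex.log_mul_eq_add_log_iff Complex.I_ne_zero hu).2 ?_
    rw [Complex.arg_I]
    constructor <;> linarith
  have l2 : Complex.log (Complex.I / u) = Complex.log Complex.I - Complex.log u := by
    rw [div_eq_mul_inv, (Complex.log_mul_eq_add_log_iff Complex.I_ne_zero (inv_ne_zero hu)).2,
      Complex.log_inv u hne, sub_eq_add_neg]
    rw [Complex.arg_I, Complex.arg_inv, if_neg hne]
    constructor <;> linarith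
  rw [Complex.cpow_def_of_ne_zero hu, Complex.cpow_def_of_ne_zero (div_ne_zero Complex.I_ne_zero hu),
    Complex.cpow_def_of_ne_zero (mul_ne_zero Complex.I_ne_zero hu), l1, l2, ← Complex.exp_add,
    ← Complex.exp_add]
  congr 1
  ring

lemma gam_piece (κ c α δ : ℝ) (hc : 0 < c) (f : ℂ → ℂ) (J : ℂ)
    (htr : ∀ v : ℂ, 0 < v.im → f ((α : ℂ) - 1 / ((c : ℂ) ^ 2 * v)) =
      J * ((c : ℂ) * v) ^ ((κ + 2 : ℝ) : ℂ) * f (v - δ))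
    (u : ℂ) (hr : 0 < u.re) (hi : 0 < u.im) :
    ((c : ℂ) * u) ^ (κ : ℂ) * ∫ s in Ioi (0:ℝ), f ((α : ℂ) - 1 / ((c : ℂ) ^ 2 * u) + s * (-1 / u)) *
      (-Complex.I * (s * (-1 / u))) ^ (κ : ℂ) * (-Complex.I * (-1 / u)) =
    -J * ∫ x in Ioo (0:ℝ) 1, f ((x : ℂ) * u - δ) * (-Complex.I * ((x : ℂ) * u - u)) ^ (κ : ℂ) *
      (-Complex.I * u) := by
  have hu : u ≠ 0 := by
    rintro rfl
    simp at hr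
  have hcC : (c : ℂ) ≠ 0 := by exact_mod_cast hc.ne'
  set φ : ℝ → ℝ := fun s => (1 + c ^ 2 * s)⁻¹ with hφ
  have himg : φ '' (Ioi 0) = Ioo 0 1 := by
    ext x
    constructor
    · rintro ⟨s, hs, rfl⟩
      have hs' : 0 < s := hs
      have : 0 < c ^ 2 * s := by positivity
      refine ⟨by simp only [hφ]; positivity, ?_⟩
      simp only [hφ]
      exact inv_lt_one_of_one_lt₀ (by linarith)
    · rintro ⟨h0, h1⟩
      refine ⟨(x⁻¹ - 1) / c ^ 2, ?_, ?_⟩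
      · have : 1 < x⁻¹ := (one_lt_inv₀ h0).2 h1
        show (0:ℝ) < (x⁻¹ - 1) / c ^ 2
        exact div_pos (by linarith) (by positivity)
      · simp only [hφ]
        field_simp
        ring
  have hinj : InjOn φ (Ioi 0) := by
    intro s hs t ht hst
    simp only [hφ, inv_inj] at hst
    have : c ^ 2 * s = c ^ 2 * t := by linarith
    exact mul_left_cancel₀ (by positivity) this
  have hder : ∀ s ∈ Ioi (0:ℝ), HasDerivWithinAt φ (-(c ^ 2) / (1 + c ^ 2 * s) ^ 2) (Ioi 0) s := by
    intro s hs
    have hs' : 0 < s := hs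
    have h1 : HasDerivAt (fun s : ℝ => 1 + c ^ 2 * s) (c ^ 2) s := by
      simpa using ((hasDerivAt_id s).const_mul (c ^ 2)).const_add 1
    exact (h1.fun_inv (by positivity)).hasDerivWithinAt
  rw [← himg, integral_image_eq_integral_abs_deriv_smul measurableSet_Ioi hder hinj,
    ← integral_const_mul, ← integral_const_mul]
  refine setIntegral_congr_fun measurableSet_Ioi ?_
  intro s hs
  have hs' : 0 < s := hs
  simp only
  set x : ℝ := φ s with hx
  have hxm : x ∈ Ioo (0:ℝ) 1 := himg ▸ mem_image_of_mem φ hs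
  obtain ⟨hx0, hx1⟩ := hxm
  have hxC : (x : ℂ) ≠ 0 := by exact_mod_cast hx0.ne'
  have hsx : s = (1 - x) / (c ^ 2 * x) := by
    have : x = (1 + c ^ 2 * s)⁻¹ := rfl
    rw [this]
    have : 0 < 1 + c ^ 2 * s := by positivity
    field_simp
    ring
  have habs : |-(c ^ 2) / (1 + c ^ 2 * s) ^ 2| = c ^ 2 * x ^ 2 := by
    have : x = (1 + c ^ 2 * s)⁻¹ := rfl
    rw [this, abs_div, abs_neg, abs_of_pos (by positivity), abs_of_pos (by positivity), inv_pow,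
      div_eq_mul_inv]
  have hsxC : (s : ℂ) = (1 - x) / (c ^ 2 * x) := by
    rw [hsx]
    push_cast
    rfl
  have earg : (α : ℂ) - 1 / ((c : ℂ) ^ 2 * u) + s * (-1 / u) =
      (α : ℂ) - 1 / ((c : ℂ) ^ 2 * ((x : ℂ) * u)) := by
    rw [hsxC]
    field_simp
    ring
  rw [earg, htr ((x : ℂ) * u) (by simp; positivity), habs]
  have p1 : -Complex.I * ((s : ℂ) * (-1 / u)) = (s : ℂ) * (Complex.I / u) := by ring
  have p2 : -Complex.I * ((x : ℂ) * u - u) = ((1 - x : ℝ) : ℂ) * (Complex.I * u) := by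
    push_cast
    ring
  have p3 : (c : ℂ) * ((x : ℂ) * u) = ((c * x : ℝ) : ℂ) * u := by
    push_cast
    ring
  have p4 : u ^ ((κ + 2 : ℝ) : ℂ) = u ^ (κ : ℂ) * u ^ 2 := by
    push_cast
    rw [Complex.cpow_add _ _ hu, Complex.cpow_ofNat]
  rw [p1, p2, p3, rmul_cpow c hc u hu, rmul_cpow (c * x) (by positivity) u hu, p4,
    rmul_cpow s hs' _ (div_ne_zero Complex.I_ne_zero hu),
    rmul_cpow (1 - x) (by linarith) _ (mul_ne_zero Complex.I_ne_zero hu), ← branch κ u hr hi]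
  have hreal : c ^ κ * (c * x) ^ (κ + 2) * s ^ κ = c ^ 2 * x ^ 2 * (1 - x) ^ κ := by
    rw [Real.rpow_add (by positivity), Real.rpow_two]
    have : (1 - x) ^ κ = c ^ κ * (c * x) ^ κ * s ^ κ := by
      rw [← Real.mul_rpow (by positivity) (by positivity),
        ← Real.mul_rpow (by positivity) (by positivity), hsx]
      congr 1
      field_simp
    rw [this]
    ring
  have hrealC : ((c ^ κ : ℝ) : ℂ) * (((c * x) ^ (κ + 2) : ℝ) : ℂ) * ((s ^ κ : ℝ) : ℂ) =
      ((c ^ 2 * x ^ 2 : ℝ) : ℂ) * (((1 - x) ^ κ : ℝ) : ℂ) := by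
    exact_mod_cast hreal
  rw [Complex.real_smul]
  have hI : -Complex.I * (-1 / u) * u ^ 2 = Complex.I * u := by
    field_simp
  linear_combination (u ^ (κ : ℂ) * u ^ (κ : ℂ) * (Complex.I / u) ^ (κ : ℂ) * J *
    f ((x : ℂ) * u - δ) * (-Complex.I * (-1 / u) * u ^ 2)) * hrealC +
    (((c ^ 2 * x ^ 2 : ℝ) : ℂ) * (((1 - x) ^ κ : ℝ) : ℂ) * u ^ (κ : ℂ) * u ^ (κ : ℂ) *
    (Complex.I / u) ^ (κ : ℂ) * J * f ((x : ℂ) * u - δ)) * hI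

lemma shift_piece (h : ℝ → ℂ) : ∫ s in Ioi (0:ℝ), h (s + 1) = ∫ x in Ioi (1:ℝ), h x := by
  have himg : (fun s : ℝ => s + 1) '' (Ioi 0) = Ioi 1 := by
    simp
  have := integral_image_eq_integral_abs_deriv_smul (f := fun s : ℝ => s + 1) (f' := fun _ => 1)
    (s := Ioi 0) measurableSet_Ioi
    (fun s _ => ((hasDerivAt_id s).add_const 1).hasDerivWithinAt)
    (fun s _ t _ h => by simpa using h) h
  rw [himg] at this
  rw [this]
  simp

lemma eich_key (p : ℕ) (k σ c α δ : ℝ) (hkp : k = p + 3 / 2) (hc : 0 < c) (f : ℂ → ℂ)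
    (hf_hol : DifferentiableOn ℂ f {z : ℂ | 0 < z.im}) (J μ : ℂ) (hJ : ‖J‖ = 1) (hμ : μ * J = 1)
    (hfb : ∀ m : ℕ, σ + 1 < m → ∃ M ≥ (0:ℝ), ∀ z : ℂ, 0 < z.im → ‖f z‖ ≤ M / z.im ^ m)
    (htr : ∀ v : ℂ, 0 < v.im →
      f ((α : ℂ) - 1 / ((c : ℂ) ^ 2 * v)) = J * ((c : ℂ) * v) ^ (k : ℂ) * f (v - δ))
    (E : ℂ → ℂ) (K : ℂ)
    (hE : ∀ z u : ℂ, 0 < z.im → 0 < u.im → E z = K * ∫ s in Ioi (0:ℝ), f (z + s * u) *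
      (-Complex.I * (s * u)) ^ ((k - 2 : ℝ) : ℂ) * (-Complex.I * u))
    (u : ℂ) (hr : 0 < u.re) (hi : 0 < u.im) :
    E (u - δ) - μ * ((c : ℂ) * u) ^ ((k - 2 : ℝ) : ℂ) * E ((α : ℂ) - 1 / ((c : ℂ) ^ 2 * u)) =
      K * ∫ y in Ioi (0:ℝ), f ((y : ℂ) * Complex.I - δ) *
        ((y : ℂ) + Complex.I * u) ^ ((k - 2 : ℝ) : ℂ) := by
  have hu : u ≠ 0 := by
    rintro rfl
    simp at hr
  have hun : 0 < ‖u‖ := norm_pos_iff.2 hu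
  set κ : ℝ := k - 2 with hκd
  have hκ : κ = p - 1 / 2 := by rw [hκd, hkp]; ring
  have hg : DifferentiableOn ℂ (fun v : ℂ => f (v - δ)) {z : ℂ | 0 < z.im} := by
    refine hf_hol.comp (by fun_prop) ?_
    intro z hz
    simpa using hz
  have hD : Decay p (fun v => f (v - δ)) := decay_g p k σ c α δ hc f J hJ hfb htr
  obtain ⟨hint, hcore⟩ := core p κ hκ _ hg hD u hr hi
  rw [Psi_I] at hcore
  have htr2 : ∀ v : ℂ, 0 < v.im → f ((α : ℂ) - 1 / ((c : ℂ) ^ 2 * v)) =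
      J * ((c : ℂ) * v) ^ ((κ + 2 : ℝ) : ℂ) * f (v - δ) := by
    intro v hv
    rw [htr v hv, hκd, sub_add_cancel]
  have hgam := gam_piece κ c α δ hc f J htr2 u hr hi
  have e1 := hE (u - δ) u (by simpa using hi) hi
  have e2 := hE ((α : ℂ) - 1 / ((c : ℂ) ^ 2 * u)) (-1 / u) (by rw [im_neg_inv]; positivity) (by
    have h := im_neg_inv 1 0 u
    have h2 : (-1 / u : ℂ) = (((0:ℝ) : ℂ) - 1 / (((1:ℝ) : ℂ) ^ 2 * u)) := by
      simp [neg_div]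
    rw [h2, h]
    positivity)
  set h : ℝ → ℂ := fun x => f ((x : ℂ) * u - δ) * (-Complex.I * ((x : ℂ) * u - u)) ^ (κ : ℂ) *
    (-Complex.I * u) with hh
  have e3 : (∫ s in Ioi (0:ℝ), f (u - δ + s * u) *
      (-Complex.I * (s * u)) ^ (κ : ℂ) * (-Complex.I * u)) = ∫ x in Ioi (1:ℝ), h x := by
    rw [← shift_piece]
    refine setIntegral_congr_fun measurableSet_Ioi ?_
    intro s hs
    simp only [hh]
    push_cast
    rw [show ((s : ℂ) + 1) * u - δ = u - δ + s * u by ring,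
      show ((s : ℂ) + 1) * u - u = s * u by ring]
  have e4 : (∫ x in Ioo (0:ℝ) 1, h x) + ∫ x in Ioi (1:ℝ), h x = Psi κ (fun v => f (v - δ)) u u := by
    have hint2 : IntegrableOn h (Ioi 0) := hint
    have : Ioi (0:ℝ) = Ioc 0 1 ∪ Ioi 1 := (Ioc_union_Ioi_eq_Ioi zero_le_one).symm
    have e5 : Psi κ (fun v => f (v - δ)) u u = ∫ x in Ioi (0:ℝ), h x := rfl
    rw [e5, this, setIntegral_union _ measurableSet_Ioi, integral_Ioc_eq_integral_Ioo]
    · exact hint2.mono_set Ioc_subset_Ioi_self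
    · exact hint2.mono_set (Ioi_subset_Ioi zero_le_one)
    · rw [Set.disjoint_left]
      intro x hx hx2
      exact absurd hx.2 (not_le.2 hx2)
  rw [e1, e2, e3]
  rw [← hcore, ← e4]
  linear_combination (-μ * K) * hgam + K * (∫ x in Ioo (0:ℝ) 1, h x) * hμ

lemma eich_analytic (p : ℕ) (k σ c α δ : ℝ) (hkp : k = p + 3 / 2) (hc : 0 < c) (f : ℂ → ℂ)
    (hf_hol : DifferentiableOn ℂ f {z : ℂ | 0 < z.im}) (J μ : ℂ) (hJ : ‖J‖ = 1) (hμ : μ * J = 1)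
    (hfb : ∀ m : ℕ, σ + 1 < m → ∃ M ≥ (0:ℝ), ∀ z : ℂ, 0 < z.im → ‖f z‖ ≤ M / z.im ^ m)
    (htr : ∀ v : ℂ, 0 < v.im →
      f ((α : ℂ) - 1 / ((c : ℂ) ^ 2 * v)) = J * ((c : ℂ) * v) ^ (k : ℂ) * f (v - δ))
    (E : ℂ → ℂ) (K : ℂ) (hEd : ∀ z : ℂ, 0 < z.im → DifferentiableAt ℂ E z)
    (hE : ∀ z u : ℂ, 0 < z.im → 0 < u.im → E z = K * ∫ s in Ioi (0:ℝ), f (z + s * u) *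
      (-Complex.I * (s * u)) ^ ((k - 2 : ℝ) : ℂ) * (-Complex.I * u)) :
    ∃ H : ℂ → ℂ, AnalyticOnNhd ℂ H {z : ℂ | (c : ℂ) * (z + δ) ∈ Complex.slitPlane} ∧
      ∀ z : ℂ, 0 < z.im → H z = E z - μ * ((c : ℂ) * (z + δ)) ^ ((k - 2 : ℝ) : ℂ) *
        E ((α : ℂ) - 1 / ((c : ℂ) ^ 2 * (z + δ))) := by
  set R : ℂ → ℂ := fun z => E z - μ * ((c : ℂ) * (z + δ)) ^ ((k - 2 : ℝ) : ℂ) *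
        E ((α : ℂ) - 1 / ((c : ℂ) ^ 2 * (z + δ))) with hR
  set G : ℂ → ℂ := fun u => ∫ y in Ioi (0:ℝ), f ((y : ℂ) * Complex.I - δ) *
        ((y : ℂ) + Complex.I * u) ^ ((k - 2 : ℝ) : ℂ) with hG
  have hg : DifferentiableOn ℂ (fun v : ℂ => f (v - δ)) {z : ℂ | 0 < z.im} := by
    refine hf_hol.comp (by fun_prop) ?_
    intro z hz
    simpa using hz
  have hD : Decay p (fun v => f (v - δ)) := decay_g p k σ c α δ hc f J hJ hfb htr
  have hGd : ∀ u : ℂ, (0 < u.re ∨ u.im < 0) → DifferentiableAt ℂ G u := fun u hu =>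
    G_diff p (k - 2) (by rw [hkp]; ring) _ hg hD u hu
  have hkey : ∀ z : ℂ, 0 < z.im → 0 < (z + δ).re → R z = K * G (z + δ) := by
    intro z hz hzr
    have := eich_key p k σ c α δ hkp hc f hf_hol J μ hJ hμ hfb htr E K hE (z + δ) hzr
      (by simpa using hz)
    rw [add_sub_cancel_right] at this
    exact this
  have hRd : ∀ z : ℂ, 0 < z.im → DifferentiableAt ℂ R z := by
    intro z hz
    have hzi : 0 < (z + δ : ℂ).im := by simpa using hz
    have hz0 : (z + δ : ℂ) ≠ 0 := by
      intro h0
      rw [h0] at hzi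
      simp at hzi
    have hzn : 0 < ‖(z + δ : ℂ)‖ := norm_pos_iff.2 hz0
    have hc0 : (c : ℂ) ≠ 0 := by exact_mod_cast hc.ne'
    have hsl : (c : ℂ) * (z + δ) ∈ Complex.slitPlane := by
      rw [Complex.mem_slitPlane_iff]
      right
      rw [Complex.im_ofReal_mul]
      positivity
    have d1 : DifferentiableAt ℂ (fun z : ℂ => ((c : ℂ) * (z + δ)) ^ ((k - 2 : ℝ) : ℂ)) z :=
      DifferentiableAt.cpow_const (by fun_prop) hsl
    have d2 : DifferentiableAt ℂ (fun z : ℂ => (α : ℂ) - 1 / ((c : ℂ) ^ 2 * (z + δ))) z := by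
      refine DifferentiableAt.const_sub (DifferentiableAt.div (by fun_prop) (by fun_prop) ?_) _
      exact mul_ne_zero (pow_ne_zero _ hc0) hz0
    have d3 : DifferentiableAt ℂ E ((α : ℂ) - 1 / ((c : ℂ) ^ 2 * (z + δ))) := by
      refine hEd _ ?_
      rw [im_neg_inv]
      positivity
    exact (hEd z hz).sub ((d1.const_mul μ).mul (d3.comp z d2))
  classical
  refine ⟨fun z => if 0 < z.im then R z else K * G (z + δ), ?_, fun z hz => by simp only [if_pos hz, hR]⟩
  have hop : IsOpen {z : ℂ | (c : ℂ) * (z + δ) ∈ Complex.slitPlane} :=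
    Complex.isOpen_slitPlane.preimage (by fun_prop)
  refine DifferentiableOn.analyticOnNhd (fun z hz => DifferentiableAt.differentiableWithinAt ?_) hop
  rcases lt_or_ge 0 z.im with him | him
  · refine (hRd z him).congr_of_eventuallyEq ?_
    have : ∀ᶠ w : ℂ in 𝓝 z, 0 < w.im :=
      (isOpen_lt continuous_const Complex.continuous_im).mem_nhds him
    filter_upwards [this] with w hw
    simp only [if_pos hw]
  · have hcase : 0 < (z + δ : ℂ).re ∨ (z + δ : ℂ).im < 0 := by
      have h1 : (c : ℂ) * (z + δ) ∈ Complex.slitPlane := hz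
      rw [Complex.mem_slitPlane_iff, Complex.re_ofReal_mul, Complex.im_ofReal_mul] at h1
      rcases h1 with h1 | h1
      · left
        exact pos_of_mul_pos_right h1 hc.le
      · right
        have h2 : (z + δ : ℂ).im ≠ 0 := right_ne_zero_of_mul h1
        have h3 : (z + δ : ℂ).im ≤ 0 := by simpa using him
        exact lt_of_le_of_ne h3 h2
    have hd : DifferentiableAt ℂ (fun z : ℂ => K * G (z + δ)) z := by
      refine DifferentiableAt.const_mul ?_ K
      exact DifferentiableAt.comp (g := G) (f := fun z : ℂ => z + δ) z (hGd _ hcase) (by fun_prop)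
    refine hd.congr_of_eventuallyEq ?_
    rcases hcase with h1 | h1
    · have : ∀ᶠ w : ℂ in 𝓝 z, 0 < (w + δ).re :=
        (isOpen_lt continuous_const (by fun_prop)).mem_nhds h1
      filter_upwards [this] with w hw
      by_cases hwi : 0 < w.im
      · simp only [if_pos hwi]
        exact hkey w hwi hw
      · simp only [if_neg hwi]
    · have : ∀ᶠ w : ℂ in 𝓝 z, (w + δ).im < 0 :=
        (isOpen_lt (by fun_prop) continuous_const).mem_nhds h1
      filter_upwards [this] with w hw
      have hwi : ¬ 0 < w.im := by
        have : w.im < 0 := by simpa using hw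
        exact not_lt.2 this.le
      simp only [if_neg hwi]

lemma mult_facts (P : Prop) [Decidable P] (ℓ : ℕ) (j : ℤ) (hj : j ^ 2 = 1) :
    ‖(if P then (1 : ℂ) else Complex.I) ^ (-(2 * (ℓ : ℤ) + 1)) * (j : ℂ)‖ = 1 ∧
    ((if P then (1 : ℂ) else -1) * (if P then (1 : ℂ) else Complex.I) ^ ((4 : ℤ) - (2 * ℓ + 1)) *
      (j : ℂ)) * ((if P then (1 : ℂ) else Complex.I) ^ (-(2 * (ℓ : ℤ) + 1)) * (j : ℂ)) = 1 := by
  have hjC : (j : ℂ) ^ 2 = 1 := by exact_mod_cast hj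
  have hjn : ‖(j : ℂ)‖ = 1 := by
    have : ‖(j : ℂ)‖ ^ 2 = 1 := by rw [← norm_pow, hjC, norm_one]
    nlinarith [norm_nonneg (j : ℂ)]
  by_cases hP : P
  · simp only [if_pos hP, one_zpow, one_mul]
    exact ⟨hjn, by rw [← hjC]; ring⟩
  · simp only [if_neg hP]
    refine ⟨by rw [norm_mul, norm_zpow, Complex.norm_I, one_zpow, hjn, one_mul], ?_⟩
    have h1 : Complex.I ^ ((4 : ℤ) - (2 * ℓ + 1)) * Complex.I ^ (-(2 * (ℓ : ℤ) + 1)) = -1 := by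
      rw [← zpow_add₀ Complex.I_ne_zero,
        show (4 : ℤ) - (2 * ℓ + 1) + -(2 * (ℓ : ℤ) + 1) = 2 + 4 * (-ℓ) by ring,
        zpow_add₀ Complex.I_ne_zero, zpow_mul]
      have h4 : Complex.I ^ (4 : ℤ) = 1 := by
        have := Complex.I_pow_four
        exact_mod_cast this
      have h2 : Complex.I ^ (2 : ℤ) = -1 := by
        have := Complex.I_sq
        exact_mod_cast this
      rw [h4, h2, one_zpow, mul_one]
    linear_combination (-(j : ℂ) ^ 2) * h1 + hjC

end

/-- holomorphic quantum modularity of the Eichler integral of a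
half-integer weight `k = ℓ + 1/2` cusp form `f` for `Γ₀(N)`, `4 ∣ N`.
Hypotheses: holomorphy, Fourier expansion with polynomially bounded
coefficients, half-integer weight-`k` slash invariance (i) (with `ε_D` equal to
`1` or `i` according to `D mod 4`, the Kronecker symbol
`(C/D) = (sign factor) · J(C | |D|)`, and the principal branch of `(Cz+D)^k`),
and exponential decay (ii) at every rational.  Conclusion: for every
`γ = (a' b'; c' d') ∈ Γ₀(N)` with `c' > 0`, the obstruction
`f̃(z) − χ₋₄(d') ε_{d'}^{4−2k} (c'/d') (c'z+d')^{k−2} f̃(γz)` agrees on `ℍ` with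
a function analytic on the cut plane `{z : c'z + d' ∉ (−∞, 0]}`. -/
theorem statement12 (ℓ : ℕ) (hℓ : 1 ≤ ℓ) (k : ℝ) (hk : k = ℓ + 1/2)
    (N : ℕ) (hN4 : 4 ∣ N)
    (f : ℂ → ℂ) (hf_hol : DifferentiableOn ℂ f {z : ℂ | 0 < z.im})
    (a : ℕ → ℂ) (C σ : ℝ) (hC : 0 < C) (hσ : 0 < σ)
    (hbound : ∀ n : ℕ, ‖a (n + 1)‖ ≤ C * ((n + 1 : ℕ) : ℝ) ^ σ)
    (hf_four : ∀ z : ℂ, 0 < z.im →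
      f z = ∑' n : ℕ, a (n + 1) *
        Complex.exp (2 * Real.pi * Complex.I * ((n : ℂ) + 1) * z))
    (htrans : ∀ A B Cm D : ℤ, A * D - B * Cm = 1 → (N : ℤ) ∣ Cm →
      ∀ z : ℂ, 0 < z.im →
        f (((A : ℂ) * z + B) / ((Cm : ℂ) * z + D)) =
          (if (D : ZMod 4) = 1 then (1 : ℂ) else Complex.I) ^ (-(2 * (ℓ : ℤ) + 1)) *
            (((if D < 0 ∧ Cm < 0 then (-1 : ℤ) else 1) * jacobiSym Cm D.natAbs : ℤ) : ℂ) *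
            ((Cm : ℂ) * z + D) ^ (k : ℂ) * f z)
    (hdecay : ∀ r : ℚ, ∃ δ > (0:ℝ), ∃ M > (0:ℝ), ∀ y : ℝ, 0 < y → y ≤ 1 →
      ‖f ((r : ℂ) + y * Complex.I)‖ ≤ M * Real.exp (-δ / y)) :
    ∀ a' b' c' d' : ℤ, a' * d' - b' * c' = 1 → (N : ℤ) ∣ c' → 0 < c' →
      ∃ H : ℂ → ℂ,
        AnalyticOnNhd ℂ H {z : ℂ | (c' : ℂ) * z + (d' : ℂ) ∈ Complex.slitPlane} ∧
        ∀ z : ℂ, 0 < z.im →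
          H z = (∑' n : ℕ, a (n + 1) * ((n + 1 : ℕ) : ℂ) ^ ((1 : ℂ) - (k : ℂ)) *
              Complex.exp (2 * Real.pi * Complex.I * ((n : ℂ) + 1) * z)) -
            (if (d' : ZMod 4) = 1 then (1 : ℂ) else -1) *
              (if (d' : ZMod 4) = 1 then (1 : ℂ) else Complex.I) ^ ((4 : ℤ) - (2 * ℓ + 1)) *
              (jacobiSym c' d'.natAbs : ℂ) *
              ((c' : ℂ) * z + d') ^ ((k : ℂ) - 2) *
              (∑' n : ℕ, a (n + 1) * ((n + 1 : ℕ) : ℂ) ^ ((1 : ℂ) - (k : ℂ)) *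
                Complex.exp (2 * Real.pi * Complex.I * ((n : ℂ) + 1) *
                  (((a' : ℂ) * z + b') / ((c' : ℂ) * z + d')))) := by
  intro a' b' c' d' hdet hN hc'
  obtain ⟨p, hp⟩ : ∃ p : ℕ, ℓ = p + 1 := ⟨ℓ - 1, by omega⟩
  have hkp : k = p + 3 / 2 := by
    rw [hk, hp]
    push_cast
    ring
  have hk1 : 1 < k := by
    have : (0:ℝ) ≤ p := by positivity
    linarith
  have hc : (0:ℝ) < (c' : ℝ) := by exact_mod_cast hc'
  have hcC : (c' : ℂ) ≠ 0 := by exact_mod_cast hc'.ne'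
  have hdetC : (a' : ℂ) * d' - b' * c' = 1 := by exact_mod_cast hdet
  have hj : jacobiSym c' d'.natAbs ^ 2 = 1 := by
    refine jacobiSym.sq_one ?_
    have hcop : IsCoprime c' d' := ⟨-b', a', by linarith⟩
    have h1 := Int.isCoprime_iff_gcd_eq_one.1 hcop
    rw [Int.gcd, Int.natAbs_natCast]
    exact h1
  obtain ⟨hJ, hμ⟩ := mult_facts ((d' : ZMod 4) = 1) ℓ _ hj
  have hfb := f_bound f a C σ hC hbound hf_four
  have hmob : ∀ z : ℂ, 0 < z.im → ((a' : ℂ) * z + b') / ((c' : ℂ) * z + d') =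
      (((a' : ℝ) / (c' : ℝ) : ℝ) : ℂ) - 1 / (((c' : ℝ) : ℂ) ^ 2 * (z + (((d' : ℝ) / (c' : ℝ) : ℝ) : ℂ))) := by
    intro z hz
    have h0 : (c' : ℂ) * z + d' ≠ 0 := by
      intro h
      have h2 := congrArg Complex.im h
      simp at h2
      rcases h2 with h2 | h2
      · exact hc'.ne' h2
      · exact hz.ne' h2
    have e : ((c' : ℂ)) ^ 2 * (z + (d' : ℂ) / c') = c' * (c' * z + d') := by
      field_simp
    push_cast
    rw [e, div_sub_div _ _ hcC (mul_ne_zero hcC h0),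
      div_eq_div_iff h0 (mul_ne_zero hcC (mul_ne_zero hcC h0))]
    linear_combination (-(c' : ℂ) * ((c' : ℂ) * z + d')) * hdetC
  have haff : ∀ z : ℂ, (c' : ℂ) * z + d' =
      ((c' : ℝ) : ℂ) * (z + (((d' : ℝ) / (c' : ℝ) : ℝ) : ℂ)) := by
    intro z
    push_cast
    field_simp
  have htr : ∀ v : ℂ, 0 < v.im →
      f ((((a' : ℝ) / (c' : ℝ) : ℝ) : ℂ) - 1 / (((c' : ℝ) : ℂ) ^ 2 * v)) =
      ((if (d' : ZMod 4) = 1 then (1 : ℂ) else Complex.I) ^ (-(2 * (ℓ : ℤ) + 1)) *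
        (jacobiSym c' d'.natAbs : ℂ)) * (((c' : ℝ) : ℂ) * v) ^ (k : ℂ) *
        f (v - (((d' : ℝ) / (c' : ℝ) : ℝ) : ℂ)) := by
    intro v hv
    have hz : 0 < (v - (((d' : ℝ) / (c' : ℝ) : ℝ) : ℂ)).im := by
      rw [Complex.sub_im, Complex.ofReal_im, sub_zero]
      exact hv
    have h1 := htrans a' b' c' d' hdet hN _ hz
    rw [hmob _ hz, haff, sub_add_cancel, if_neg (show ¬ (d' < 0 ∧ c' < 0) from fun h => by omega),
      one_mul] at h1
    exact h1
  obtain ⟨H, hH, hHz⟩ := eich_analytic p k σ c' ((a' : ℝ) / (c' : ℝ)) ((d' : ℝ) / (c' : ℝ)) hkp hc f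
    hf_hol _ _ hJ hμ hfb htr _ _ (eich_diff k hk1 a C σ hC hbound)
    (eich_int k hk1 f a C σ hC hbound hf_four)
  refine ⟨H, ?_, ?_⟩
  · intro z hz
    refine hH z ?_
    have hz2 : (c' : ℂ) * z + d' ∈ Complex.slitPlane := hz
    rw [haff] at hz2
    exact hz2
  · intro z hz
    rw [hHz z hz, hmob z hz, haff z, Complex.ofReal_sub, Complex.ofReal_ofNat]
end

section
/- Let d(m) denote the number of positive divisors of m. For every u ∈ ℂ with |u| < 2π, all the series below converge absolutely and −(8/(πi)) · ∑_{n ≥ 1, n odd} ( ∑_{m≥1} d(m) (2πim)^{−(n+1)} ) u^n = (8/(πi)) · ∑_{m≥1} d(m) · u/(u² + 4π²m²). Moreover, the right-hand side defines a meromorphic function on all of ℂ whose only singularities are simple poles at the points u = 2πim for m ∈ ℤ ∖ {0}, with residue 4 d(|m|)/(πi) at u = 2πim. -/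
open Filter Topology

lemma aux_summable : Summable (fun m : ℕ => ((m + 1).divisors.card : ℝ) / ((m : ℝ) + 1) ^ 2) := by
  have h1 : LSeriesSummable (1 : ℕ → ℂ) 2 := LSeriesSummable_one_iff.mpr (by norm_num)
  have h2 := (h1.convolution h1).norm
  have h3 := (summable_nat_add_iff 1).mpr h2
  refine h3.congr fun m => ?_
  rw [LSeries.term_of_ne_zero (by omega), LSeries.convolution_def]
  have : ∑ p ∈ (m + 1).divisorsAntidiagonal, (1 : ℕ → ℂ) p.1 * (1 : ℕ → ℂ) p.2
      = ((m + 1).divisors.card : ℂ) := by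
    rw [← Nat.map_div_right_divisors]
    simp
  beta_reduce
  rw [this, norm_div]
  norm_cast

/-- the terms -/
noncomputable def tt (m : ℕ) (u : ℂ) : ℂ := (((m + 1).divisors.card : ℂ)) * u /
          (u ^ 2 + 4 * (Real.pi : ℂ) ^ 2 * ((m : ℂ) + 1) ^ 2)

lemma den_bound (m : ℕ) (u : ℂ) (R : ℝ) (hu : ‖u‖ ≤ R) (hm : R ≤ m + 1) :
    ((m : ℝ) + 1) ^ 2 ≤ ‖u ^ 2 + 4 * (Real.pi : ℂ) ^ 2 * ((m : ℂ) + 1) ^ 2‖ := by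
  have h1 : ‖4 * (Real.pi : ℂ) ^ 2 * ((m : ℂ) + 1) ^ 2‖ = 4 * Real.pi ^ 2 * ((m : ℝ) + 1) ^ 2 := by
    have : (4 * (Real.pi : ℂ) ^ 2 * ((m : ℂ) + 1) ^ 2) =
      ((4 * Real.pi ^ 2 * ((m : ℝ) + 1) ^ 2 : ℝ) : ℂ) := by push_cast; ring
    rw [this, Complex.norm_real, Real.norm_of_nonneg (by positivity)]
  have h2 : ‖u ^ 2‖ ≤ ((m : ℝ) + 1) ^ 2 := by
    rw [norm_pow]; gcongr; linarith
  have h3 := norm_sub_le (u ^ 2 + 4 * (Real.pi : ℂ) ^ 2 * ((m : ℂ) + 1) ^ 2) (u ^ 2)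
  rw [add_sub_cancel_left, h1] at h3
  have h4 : 2 * ((m : ℝ) + 1) ^ 2 ≤ 4 * Real.pi ^ 2 * ((m : ℝ) + 1) ^ 2 := by
    have := Real.pi_gt_three
    gcongr; nlinarith
  linarith

lemma tt_bound (m : ℕ) (u : ℂ) (R : ℝ) (hu : ‖u‖ ≤ R) (hm : R ≤ m + 1) :
    ‖tt m u‖ ≤ R * (((m + 1).divisors.card : ℝ) / ((m : ℝ) + 1) ^ 2) := by
  have h := den_bound m u R hu hm
  have hp : (0 : ℝ) < ((m : ℝ) + 1) ^ 2 := by positivity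
  have hR : 0 ≤ R := (norm_nonneg u).trans hu
  rw [tt, norm_div, norm_mul, Complex.norm_natCast, ← mul_div_assoc, mul_comm R]
  gcongr

lemma tt_summable (u : ℂ) : Summable (fun m => ‖tt m u‖) := by
  refine (Summable.of_norm_bounded_eventually_nat (aux_summable.mul_left ‖u‖) ?_)
  obtain ⟨N, hN⟩ := exists_nat_ge ‖u‖
  filter_upwards [eventually_ge_atTop N] with m hm
  rw [norm_norm]
  refine tt_bound m u _ le_rfl ?_
  have : (N : ℝ) ≤ m := by exact_mod_cast hm
  linarith

lemma tail_diff (R : ℝ) (N : ℕ) (hN : R ≤ N) :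
    DifferentiableOn ℂ (fun u => ∑' m : ℕ, tt (m + N) u) (Metric.ball 0 R) := by
  have hb : ∀ m : ℕ, R ≤ ((m + N : ℕ) : ℝ) + 1 := fun m => by push_cast; linarith [(Nat.cast_nonneg m : (0:ℝ) ≤ m)]
  refine Complex.differentiableOn_tsum_of_summable_norm
    ((summable_nat_add_iff N).mpr (aux_summable.mul_left R)) ?_ Metric.isOpen_ball ?_
  · intro m u hu
    have hu' : ‖u‖ ≤ R := by simpa using (Metric.mem_ball.mp hu).le
    have := den_bound (m + N) u R hu' (hb m)
    have hp : (0 : ℝ) < (((m + N : ℕ) : ℝ) + 1) ^ 2 := by positivity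
    have h0 : u ^ 2 + 4 * (Real.pi : ℂ) ^ 2 * (((m + N : ℕ) : ℂ) + 1) ^ 2 ≠ 0 :=
      norm_pos_iff.mp (hp.trans_le this)
    unfold tt
    apply DifferentiableAt.differentiableWithinAt
    fun_prop (disch := exact h0)
  · intro m u hu
    exact tt_bound _ u R (by simpa using (Metric.mem_ball.mp hu).le) (hb m)

lemma split (u : ℂ) (N : ℕ) :
    ∑' m, tt m u = ∑ m ∈ Finset.range N, tt m u + ∑' m, tt (m + N) u :=
  ((tt_summable u).of_norm.sum_add_tsum_nat_add N).symm

lemma den_factor (m : ℕ) (u : ℂ) : u ^ 2 + 4 * (Real.pi : ℂ) ^ 2 * ((m : ℂ) + 1) ^ 2 =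
    (u - 2 * Real.pi * Complex.I * (m + 1)) * (u + 2 * Real.pi * Complex.I * (m + 1)) := by
  ring_nf
  rw [Complex.I_sq]; ring

lemma den_zero {m : ℕ} {u : ℂ} (h : u ^ 2 + 4 * (Real.pi : ℂ) ^ 2 * ((m : ℂ) + 1) ^ 2 = 0) :
    ∃ k : ℤ, k.natAbs = m + 1 ∧ u = 2 * (Real.pi : ℂ) * Complex.I * k := by
  rw [den_factor, mul_eq_zero] at h
  rcases h with h | h
  · exact ⟨m + 1, by omega, by push_cast; linear_combination h⟩
  · exact ⟨-(m + 1), by omega, by push_cast; linear_combination h⟩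

lemma part2 : AnalyticOnNhd ℂ (fun u : ℂ => 8 / ((Real.pi : ℂ) * Complex.I) * ∑' m : ℕ, tt m u)
      {u : ℂ | ∀ m : ℤ, m ≠ 0 → u ≠ 2 * (Real.pi : ℂ) * Complex.I * m} := by
  intro u hu
  obtain ⟨N, hN⟩ := exists_nat_gt ‖u‖
  refine analyticAt_const.mul ?_
  simp_rw [split _ N]
  refine AnalyticAt.add ?_ ?_
  · refine Finset.analyticAt_fun_sum _ fun m _ => ?_
    have h0 : u ^ 2 + 4 * (Real.pi : ℂ) ^ 2 * ((m : ℂ) + 1) ^ 2 ≠ 0 := by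
      intro h
      obtain ⟨k, hk, e⟩ := den_zero h
      exact hu k (by omega) e
    unfold tt
    fun_prop (disch := exact h0)
  · exact (tail_diff N N le_rfl).analyticAt (Metric.isOpen_ball.mem_nhds (by simpa using hN))

lemma two_pi_inj {k l : ℤ} (h : 2 * (Real.pi : ℂ) * Complex.I * k = 2 * (Real.pi : ℂ) * Complex.I * l) :
    k = l := by
  have := mul_left_cancel₀ Complex.two_pi_I_ne_zero h
  exact_mod_cast this

lemma part3 (m : ℤ) (hm : m ≠ 0) :
      Tendsto
        (fun u : ℂ => (u - 2 * (Real.pi : ℂ) * Complex.I * m) *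
          (8 / ((Real.pi : ℂ) * Complex.I) * ∑' j : ℕ, tt j u))
        (𝓝[≠] (2 * (Real.pi : ℂ) * Complex.I * m))
        (𝓝 (4 * ((m.natAbs.divisors.card : ℂ)) / ((Real.pi : ℂ) * Complex.I))) := by
  set a : ℂ := 2 * (Real.pi : ℂ) * Complex.I * m with ha
  have ha0 : a ≠ 0 := mul_ne_zero Complex.two_pi_I_ne_zero (by exact_mod_cast hm)
  obtain ⟨N0, hN0⟩ := exists_nat_gt ‖a‖
  set N := max N0 m.natAbs with hNdef
  have hN : ‖a‖ < N := hN0.trans_le (by exact_mod_cast le_max_left _ _)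
  have hid : Tendsto (fun u : ℂ => u - a) (𝓝[≠] a) (𝓝 0) := by
    have : Tendsto (fun u : ℂ => u - a) (𝓝 a) (𝓝 (a - a)) := by
      apply Continuous.tendsto; fun_prop
    rw [sub_self] at this
    exact this.mono_left nhdsWithin_le_nhds
  have htail : Tendsto (fun u => (u - a) * ∑' j, tt (j + N) u) (𝓝[≠] a) (𝓝 0) := by
    have h1 : ContinuousAt (fun u => ∑' j, tt (j + N) u) a :=
      ((tail_diff N N le_rfl).analyticAt
        (Metric.isOpen_ball.mem_nhds (by simpa using hN))).continuousAt
    simpa using hid.mul (h1.tendsto.mono_left nhdsWithin_le_nhds)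
  have hterm : ∀ j ∈ Finset.range N, Tendsto (fun u => (u - a) * tt j u) (𝓝[≠] a)
      (𝓝 (if j = m.natAbs - 1 then (m.natAbs.divisors.card : ℂ) / 2 else 0)) := by
    intro j _
    split_ifs with hj
    · have hj' : m.natAbs = j + 1 := by omega
      have hc : Tendsto (fun u : ℂ => ((j + 1).divisors.card : ℂ) * u / (u + a)) (𝓝[≠] a)
          (𝓝 (((j + 1).divisors.card : ℂ) * a / (a + a))) := by
        have h0 : a + a ≠ 0 := by rw [← two_mul]; exact mul_ne_zero two_ne_zero ha0
        have : ContinuousAt (fun u : ℂ => ((j + 1).divisors.card : ℂ) * u / (u + a)) a := by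
          fun_prop (disch := exact h0)
        exact this.tendsto.mono_left nhdsWithin_le_nhds
      have he : ((j + 1).divisors.card : ℂ) * a / (a + a) = (m.natAbs.divisors.card : ℂ) / 2 := by
        rw [hj']; field_simp; ring
      rw [he] at hc
      refine hc.congr' ?_
      filter_upwards [self_mem_nhdsWithin] with u hu
      have hua : u - a ≠ 0 := sub_ne_zero.mpr hu
      have hden : u ^ 2 + 4 * (Real.pi : ℂ) ^ 2 * ((j : ℂ) + 1) ^ 2 = (u - a) * (u + a) := by
        rw [den_factor]
        have : (m : ℂ) ^ 2 = ((j : ℂ) + 1) ^ 2 := by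
          have : m ^ 2 = ((j : ℤ) + 1) ^ 2 := by
            rw [← Int.natAbs_sq, hj']; push_cast; ring
          exact_mod_cast this
        rw [ha]
        linear_combination (4 * (Real.pi : ℂ) ^ 2 * Complex.I ^ 2) * this
      rw [tt, hden, ← mul_div_assoc, mul_div_mul_left _ _ hua]
    · have h0 : a ^ 2 + 4 * (Real.pi : ℂ) ^ 2 * ((j : ℂ) + 1) ^ 2 ≠ 0 := by
        intro h
        obtain ⟨k, hk, e⟩ := den_zero h
        have := two_pi_inj e
        subst this
        omega
      have : ContinuousAt (tt j) a := by
        unfold tt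
        fun_prop (disch := exact h0)
      simpa using hid.mul (this.tendsto.mono_left nhdsWithin_le_nhds)
  have hall := ((tendsto_finsetSum _ hterm).add htail).const_mul (8 / ((Real.pi : ℂ) * Complex.I))
  have hmem : m.natAbs - 1 ∈ Finset.range N := by
    rw [Finset.mem_range]; omega
  rw [Finset.sum_ite_eq_of_mem' _ _ _ hmem, add_zero] at hall
  have hlim : 8 / ((Real.pi : ℂ) * Complex.I) * ((m.natAbs.divisors.card : ℂ) / 2) =
    4 * ((m.natAbs.divisors.card : ℂ)) / ((Real.pi : ℂ) * Complex.I) := by ring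
  rw [hlim] at hall
  refine hall.congr fun u => ?_
  rw [split u N, ← Finset.mul_sum]
  ring

/-- the base points -/
noncomputable def bb (m : ℕ) : ℂ := 2 * (Real.pi : ℂ) * Complex.I * ((m : ℂ) + 1)

lemma bb_norm (m : ℕ) : ‖bb m‖ = 2 * Real.pi * (m + 1) := by
  have : ‖(m : ℂ) + 1‖ = m + 1 := by
    have := Complex.norm_natCast (m + 1); push_cast at this; exact this
  simp [bb, this, abs_of_pos Real.pi_pos]

lemma term_bound (n m : ℕ) (hn : 1 ≤ n) (u : ℂ) :
    ‖((m + 1).divisors.card : ℂ) * bb m ^ (-((n : ℤ) + 1)) * u ^ n‖ ≤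
      (‖u‖ / (2 * Real.pi)) ^ n * (((m + 1).divisors.card : ℝ) / ((m : ℝ) + 1) ^ 2) := by
  have hz : bb m ^ (-((n : ℤ) + 1)) = (bb m ^ (n + 1))⁻¹ := by
    rw [zpow_neg]; norm_cast
  have hpi := Real.pi_gt_three
  rw [hz, norm_mul, norm_mul, norm_inv, norm_pow, norm_pow, bb_norm, Complex.norm_natCast, div_pow]
  have h1 : ((m : ℝ) + 1) ^ 2 ≤ ((m : ℝ) + 1) ^ (n + 1) :=
    pow_le_pow_right₀ (by linarith [(Nat.cast_nonneg m : (0:ℝ) ≤ m)]) (by omega)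
  have h2 : (2 * Real.pi) ^ n ≤ (2 * Real.pi) ^ (n + 1) :=
    pow_le_pow_right₀ (by linarith) (by omega)
  have h3 : (2 * Real.pi) ^ n * ((m : ℝ) + 1) ^ 2 ≤ (2 * Real.pi * (m + 1)) ^ (n + 1) := by
    rw [mul_pow (2 * Real.pi)]; exact mul_le_mul h2 h1 (by positivity) (by positivity)
  calc ((m + 1).divisors.card : ℝ) * ((2 * Real.pi * (m + 1)) ^ (n + 1))⁻¹ * ‖u‖ ^ n
      ≤ ((m + 1).divisors.card : ℝ) * ((2 * Real.pi) ^ n * ((m : ℝ) + 1) ^ 2)⁻¹ * ‖u‖ ^ n := by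
        gcongr
    _ = _ := by
        rw [mul_inv]; ring

lemma part1a (n : ℕ) (hn : 1 ≤ n) :
    Summable (fun m : ℕ => ‖((m + 1).divisors.card : ℂ) * bb m ^ (-((n : ℤ) + 1))‖) := by
  refine Summable.of_nonneg_of_le (fun _ => norm_nonneg _) (fun m => ?_)
    (aux_summable.mul_left ((‖(1:ℂ)‖ / (2 * Real.pi)) ^ n))
  simpa using term_bound n m hn 1

/-- double series -/
noncomputable def ff (u : ℂ) (n m : ℕ) : ℂ :=
  if Odd n then ((m + 1).divisors.card : ℂ) * bb m ^ (-((n : ℤ) + 1)) * u ^ n else 0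

lemma ff_summable (u : ℂ) (hu : ‖u‖ < 2 * Real.pi) :
    Summable (fun p : ℕ × ℕ => ‖ff u p.1 p.2‖) := by
  have hr : ‖u‖ / (2 * Real.pi) < 1 := by rw [div_lt_one Real.two_pi_pos]; exact hu
  have hr0 : 0 ≤ ‖u‖ / (2 * Real.pi) := by positivity
  have := (summable_geometric_of_lt_one hr0 hr).mul_of_nonneg aux_summable
    (fun n => by positivity) (fun m => by positivity)
  refine Summable.of_nonneg_of_le (fun _ => norm_nonneg _) (fun p => ?_) this
  unfold ff
  split_ifs with h
  · exact term_bound p.1 p.2 h.pos u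
  · rw [norm_zero]; positivity

lemma ff_tsum (u : ℂ) (n : ℕ) : ∑' m, ff u n m =
    if Odd n then (∑' m : ℕ, ((m + 1).divisors.card : ℂ) * bb m ^ (-((n : ℤ) + 1))) * u ^ n
      else 0 := by
  unfold ff
  split_ifs
  · rw [tsum_mul_right]
  · simp

lemma ff_tsum' (u : ℂ) (hu : ‖u‖ < 2 * Real.pi) (m : ℕ) : ∑' n, ff u n m = - tt m u := by
  have hb : bb m ≠ 0 := by
    rw [← norm_pos_iff, bb_norm]; have := Real.pi_pos; positivity
  have hr : ‖u‖ < ‖bb m‖ := by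
    rw [bb_norm]
    have := Real.pi_pos
    nlinarith [(Nat.cast_nonneg m : (0:ℝ) ≤ m)]
  have hw : ‖(u / bb m) ^ 2‖ < 1 := by
    rw [norm_pow, norm_div]
    have : ‖u‖ / ‖bb m‖ < 1 := by rw [div_lt_one ((norm_nonneg u).trans_lt hr)]; exact hr
    exact pow_lt_one₀ (by positivity) this two_ne_zero
  have hg := (hasSum_geometric_of_norm_lt_one hw).mul_left
    (((m + 1).divisors.card : ℂ) * u / bb m ^ 2)
  have hinj : Function.Injective (fun k : ℕ => 2 * k + 1) := fun a b h => by
    simp only at h; omega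
  have hsupp : ∀ x ∉ Set.range (fun k : ℕ => 2 * k + 1), ff u x m = 0 := by
    intro x hx
    unfold ff
    rw [if_neg]
    rintro ⟨k, rfl⟩
    exact hx ⟨k, rfl⟩
  have h2 : HasSum (fun n => ff u n m)
      (((m + 1).divisors.card : ℂ) * u / bb m ^ 2 * (1 - (u / bb m) ^ 2)⁻¹) := by
    rw [← hinj.hasSum_iff hsupp]
    convert! hg using 2 with k
    simp only [Function.comp, ff]
    rw [if_pos ⟨k, rfl⟩]
    have hz : bb m ^ (-(((2 * k + 1 : ℕ) : ℤ) + 1)) = (bb m ^ (2 * k + 2))⁻¹ := by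
      rw [zpow_neg]; norm_cast
    rw [hz, div_pow, div_pow, ← pow_mul, ← pow_mul]
    field_simp
    ring
  rw [h2.tsum_eq, tt]
  have hb2 : 4 * (Real.pi : ℂ) ^ 2 * ((m : ℂ) + 1) ^ 2 = - bb m ^ 2 := by
    unfold bb
    linear_combination (4 * (Real.pi : ℂ) ^ 2 * ((m : ℂ) + 1) ^ 2) * Complex.I_sq
  have hd : bb m ^ 2 - u ^ 2 ≠ 0 := by
    intro h
    have : ‖bb m‖ ^ 2 = ‖u‖ ^ 2 := by rw [← norm_pow, ← norm_pow, sub_eq_zero.mp h]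
    nlinarith [norm_nonneg u]
  rw [hb2]
  have hd' : u ^ 2 + - bb m ^ 2 ≠ 0 := fun h => hd (by linear_combination -h)
  have hd'' : 1 - (u / bb m) ^ 2 ≠ 0 := by
    rw [div_pow]; intro h; apply hd; field_simp at h; linear_combination h
  have e : bb m ^ 2 * (1 - (u / bb m) ^ 2) = -(u ^ 2 + - bb m ^ 2) := by field_simp; ring
  rw [← div_eq_mul_inv, div_div, e, div_neg]

lemma part1 (u : ℂ) (hu : ‖u‖ < 2 * Real.pi) :
    Summable (fun n => ‖∑' m, ff u n m‖) ∧ ∑' n, ∑' m, ff u n m = - ∑' m, tt m u := by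
  have hs := ff_summable u hu
  refine ⟨?_, ?_⟩
  · refine Summable.of_nonneg_of_le (fun _ => norm_nonneg _) (fun n => ?_) hs.prod
    exact norm_tsum_le_tsum_norm (hs.prod_factor n)
  · have := Summable.tsum_comm (f := ff u) hs.of_norm
    rw [← this, ← tsum_neg]
    exact tsum_congr fun m => ff_tsum' u hu m


open Filter Topology

/-- the Borel transform of the divisor asymptotic series.  For
`‖u‖ < 2π` all three series converge absolutely and
`−(8/(πi)) ∑_{n odd} (∑_{m≥1} d(m)(2πim)^{−(n+1)}) uⁿ
  = (8/(πi)) ∑_{m≥1} d(m) u/(u² + 4π²m²)`.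
Moreover the right-hand side is analytic away from the points `2πim`
(`m ∈ ℤ ∖ {0}`), where it has simple poles with residue `4d(|m|)/(πi)`. -/
theorem statement14 :
    (∀ u : ℂ, ‖u‖ < 2 * Real.pi →
      (∀ n : ℕ, 1 ≤ n → Summable (fun m : ℕ =>
        ‖(((m + 1).divisors.card : ℂ)) *
          (2 * (Real.pi : ℂ) * Complex.I * ((m : ℂ) + 1)) ^ (-((n : ℤ) + 1))‖)) ∧
      Summable (fun n : ℕ =>
        ‖if Odd n then
            (∑' m : ℕ, (((m + 1).divisors.card : ℂ)) *
              (2 * (Real.pi : ℂ) * Complex.I * ((m : ℂ) + 1)) ^ (-((n : ℤ) + 1))) * u ^ n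
          else 0‖) ∧
      Summable (fun m : ℕ =>
        ‖(((m + 1).divisors.card : ℂ)) * u /
          (u ^ 2 + 4 * (Real.pi : ℂ) ^ 2 * ((m : ℂ) + 1) ^ 2)‖) ∧
      -(8 / ((Real.pi : ℂ) * Complex.I)) *
          ∑' n : ℕ,
            (if Odd n then
              (∑' m : ℕ, (((m + 1).divisors.card : ℂ)) *
                (2 * (Real.pi : ℂ) * Complex.I * ((m : ℂ) + 1)) ^ (-((n : ℤ) + 1))) * u ^ n
            else 0) =
        8 / ((Real.pi : ℂ) * Complex.I) *
          ∑' m : ℕ, (((m + 1).divisors.card : ℂ)) * u /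
            (u ^ 2 + 4 * (Real.pi : ℂ) ^ 2 * ((m : ℂ) + 1) ^ 2)) ∧
    (AnalyticOnNhd ℂ
      (fun u : ℂ => 8 / ((Real.pi : ℂ) * Complex.I) *
        ∑' m : ℕ, (((m + 1).divisors.card : ℂ)) * u /
          (u ^ 2 + 4 * (Real.pi : ℂ) ^ 2 * ((m : ℂ) + 1) ^ 2))
      {u : ℂ | ∀ m : ℤ, m ≠ 0 → u ≠ 2 * (Real.pi : ℂ) * Complex.I * m}) ∧
    ∀ m : ℤ, m ≠ 0 →
      Tendsto
        (fun u : ℂ => (u - 2 * (Real.pi : ℂ) * Complex.I * m) *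
          (8 / ((Real.pi : ℂ) * Complex.I) *
            ∑' j : ℕ, (((j + 1).divisors.card : ℂ)) * u /
              (u ^ 2 + 4 * (Real.pi : ℂ) ^ 2 * ((j : ℂ) + 1) ^ 2)))
        (𝓝[≠] (2 * (Real.pi : ℂ) * Complex.I * m))
        (𝓝 (4 * ((m.natAbs.divisors.card : ℂ)) / ((Real.pi : ℂ) * Complex.I))) := by
  refine ⟨fun u hu => ⟨fun n hn => part1a n hn, ?_, tt_summable u, ?_⟩, part2, part3⟩
  · exact (part1 u hu).1.congr fun n => by rw [ff_tsum]; rfl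
  · have h := (part1 u hu).2
    simp_rw [ff_tsum] at h
    have h2 := congrArg (fun x => -(8 / ((Real.pi : ℂ) * Complex.I)) * x) h
    simp only [neg_mul_neg] at h2
    exact h2
end
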